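/- Let N ∈ {1,2,4}, let λ ≥ 0 be an integer, let p be a prime and 𝔭 a prime ideal of 𝒪_L dividing p. Let f be a cusp form of weight λ+1/2 on Γ₀(4N) such that every Fourier coefficient a_f(n) at ∞ lies in L and is 𝔭-integral. Assume that p = 2, or that p is odd and either λ ≡ 2 (mod (p−1)/2), or N = 1 and λ ≡ 3 (mod (p−1)/2). Then there exists a positive integer b such that a_f(n·p^b) ≡ 0 (mod 𝔭) for every positive integer n. -/

import Mathlib

open Complex UpperHalfPlane Matrix MatrixGroups CongruenceSubgroup Filter Topology Manifold
open scoped Real NumberField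

set_option synthInstance.maxHeartbeats 1000000
set_option maxHeartbeats 1000000

noncomputable section

/-- The Jacobi theta function `θ(τ) = Σ_{n ∈ ℤ} e^{2πin²τ}`. -/
def Theta (τ : ℍ) : ℂ := ∑' n : ℤ, Complex.exp (2 * Real.pi * Complex.I * (n : ℂ) ^ 2 * (τ : ℂ))

/-- `cτ + d` for `σ = (a,b;c,d) ∈ SL₂(ℤ)`. -/
def denomC (σ : SL(2, ℤ)) (τ : ℍ) : ℂ := (σ 1 0 : ℂ) * (τ : ℂ) + (σ 1 1 : ℂ)

/-- `f` admits at the cusp `σ∞` an expansion `(cτ+d)^{-k} f(στ) = Σ_n c(n) e^{2πinτ/M}`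
(principal branch) with coefficients `c`, width `M > 0`, coefficients vanishing below some `s₀`,
the series converging absolutely, and uniformly on `{Im τ ≥ y₀}` for every `y₀ > 0`. -/
def CuspExpansion (k : ℂ) (f : ℍ → ℂ) (σ : SL(2, ℤ)) (M : ℕ) (c : ℤ → ℂ) : Prop :=
  0 < M ∧ (∃ s₀ : ℤ, ∀ n : ℤ, n < s₀ → c n = 0) ∧
  ∀ y₀ : ℝ, 0 < y₀ →
    (∀ τ : ℍ, y₀ ≤ τ.im →
      Summable fun n : ℤ => ‖c n * Complex.exp (2 * Real.pi * Complex.I * n * τ / M)‖) ∧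
    TendstoUniformlyOn
      (fun (s : Finset ℤ) (τ : ℍ) =>
        ∑ n ∈ s, c n * Complex.exp (2 * Real.pi * Complex.I * n * τ / M))
      (fun τ => (denomC σ τ) ^ (-k) * f (σ • τ))
      Filter.atTop {τ : ℍ | y₀ ≤ τ.im}

/-- Weakly holomorphic modular form of weight `lam + 1/2` on `Γ₀(4N)`. -/
structure IsWeaklyHolo (N : ℕ) (lam : ℤ) (f : ℍ → ℂ) : Prop where
  holo : MDifferentiable 𝓘(ℂ) 𝓘(ℂ) f
  transf : ∀ γ ∈ Gamma0 (4 * N), ∀ τ : ℍ,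
    f (γ • τ) = (Theta (γ • τ) / Theta τ) ^ (2 * lam + 1 : ℤ) * f τ
  cusp : ∀ σ : SL(2, ℤ), ∃ (M : ℕ) (c : ℤ → ℂ), CuspExpansion ((lam : ℂ) + 1 / 2) f σ M c

/-- Holomorphic modular form of weight `lam + 1/2` on `Γ₀(4N)`: at every cusp one can take the
expansion to start at `0`. -/
structure IsHoloForm (N : ℕ) (lam : ℤ) (f : ℍ → ℂ) : Prop where
  holo : MDifferentiable 𝓘(ℂ) 𝓘(ℂ) f
  transf : ∀ γ ∈ Gamma0 (4 * N), ∀ τ : ℍ,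
    f (γ • τ) = (Theta (γ • τ) / Theta τ) ^ (2 * lam + 1 : ℤ) * f τ
  cusp : ∀ σ : SL(2, ℤ), ∃ (M : ℕ) (c : ℤ → ℂ),
    CuspExpansion ((lam : ℂ) + 1 / 2) f σ M c ∧ ∀ n : ℤ, n < 0 → c n = 0

/-- Cusp form of weight `lam + 1/2` on `Γ₀(4N)`: holomorphic form all of whose slashes tend to
`0` as `Im τ → ∞`. -/
structure IsCuspFormHalf (N : ℕ) (lam : ℤ) (f : ℍ → ℂ) : Prop where
  toIsHoloForm : IsHoloForm N lam f
  decay : ∀ σ : SL(2, ℤ),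
    Filter.Tendsto (fun τ : ℍ => (denomC σ τ) ^ (-((lam : ℂ) + 1 / 2)) * f (σ • τ))
      (Filter.comap UpperHalfPlane.im Filter.atTop) (nhds 0)

/-- `f(τ) = Σ_{n ∈ ℤ} a(n) e^{2πinτ}` is the Fourier expansion of `f` at `∞`. -/
def FourierAtInfty (f : ℍ → ℂ) (a : ℤ → ℂ) : Prop :=
  ∀ τ : ℍ, HasSum (fun n : ℤ => a n * Complex.exp (2 * Real.pi * Complex.I * n * τ)) (f τ)

/-- `x ≡ y (mod 𝔭^j)` for elements of `ℂ` lying in `L`: `(x - y)·b = a` with `a ∈ 𝔭^j`,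
`b ∉ 𝔭`, i.e. `v_𝔭(x - y) ≥ j`. -/
def CongMod (L : Subfield ℂ) (P : Ideal (𝓞 L)) (j : ℕ) (x y : ℂ) : Prop :=
  ∃ a b : 𝓞 L, a ∈ P ^ j ∧ b ∉ P ∧ (x - y) * ((b : L) : ℂ) = ((a : L) : ℂ)

/-- `x` is `𝔭`-integral: `x·b = a` with `a ∈ 𝒪_L`, `b ∈ 𝒪_L ∖ 𝔭`. -/
def PIntegral (L : Subfield ℂ) (P : Ideal (𝓞 L)) (x : ℂ) : Prop :=
  ∃ a b : 𝓞 L, b ∉ P ∧ x * ((b : L) : ℂ) = ((a : L) : ℂ)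

lemma denom_eq_denomC (γ : SL(2, ℤ)) (τ : ℍ) : UpperHalfPlane.denom γ τ = denomC γ τ := by
  simp [denomC, UpperHalfPlane.denom]

lemma denomC_ne_zero (γ : SL(2, ℤ)) (τ : ℍ) : denomC γ τ ≠ 0 := by
  rw [← denom_eq_denomC]; exact UpperHalfPlane.denom_ne_zero _ τ

@[simp] lemma denomC_one (τ : ℍ) : denomC 1 τ = 1 := by simp [denomC]

@[simp] lemma denomC_T (τ : ℍ) : denomC ModularGroup.T τ = 1 := by
  simp [denomC, ModularGroup.coe_T]

@[simp] lemma denomC_S (τ : ℍ) : denomC ModularGroup.S τ = τ := by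
  simp [denomC, ModularGroup.coe_S]

lemma coe_S_smul (τ : ℍ) : ((ModularGroup.S • τ : ℍ) : ℂ) = -1 / τ := by
  rw [UpperHalfPlane.modular_S_smul, neg_div, one_div]
  exact inv_neg

lemma coe_T_smul (τ : ℍ) : ((ModularGroup.T • τ : ℍ) : ℂ) = τ + 1 := by
  rw [UpperHalfPlane.modular_T_smul, UpperHalfPlane.coe_vadd]; simp [add_comm]

lemma coe_SL_smul (γ : SL(2, ℤ)) (τ : ℍ) :
    ((γ • τ : ℍ) : ℂ) = ((γ 0 0 : ℂ) * τ + γ 0 1) / denomC γ τ := by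
  rw [UpperHalfPlane.specialLinearGroup_apply]; simp [denomC]

lemma denomC_mul (γ γ' : SL(2, ℤ)) (τ : ℍ) :
    denomC (γ * γ') τ = denomC γ (γ' • τ) * denomC γ' τ := by
  have h := denomC_ne_zero γ' τ
  rw [denomC, denomC, coe_SL_smul]
  field_simp
  have e : ∀ j, (γ * γ') 1 j = γ 1 0 * γ' 0 j + γ 1 1 * γ' 1 j := fun j => by
    have : ((γ : Matrix (Fin 2) (Fin 2) ℤ) * γ') 1 j = _ := Matrix.mul_apply
    rw [Fin.sum_univ_two] at this
    exact this
  rw [e, e, denomC]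
  push_cast
  ring

lemma im_SL_smul (γ : SL(2, ℤ)) (τ : ℍ) : (γ • τ).im = τ.im / ‖denomC γ τ‖ ^ 2 := by
  rw [ModularGroup.im_smul_eq_div_normSq, denom_eq_denomC, Complex.normSq_eq_norm_sq]

lemma integral_eq_zero_of_weight_two {g : ℂ → ℂ} (hg : DifferentiableOn ℂ g {z | 0 < z.im})
    (hT : ∀ z : ℂ, 0 < z.im → g (z + 1) = g z)
    (hS : ∀ z : ℂ, 0 < z.im → g (-1 / z) = z ^ 2 * g z) {y : ℝ} (hy : 0 < y) :
    ∫ x in (0 : ℝ)..1, g (x + y * Complex.I) = 0 := by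
  have hconv : Convex ℝ {z : ℂ | 0 < z.im} := convex_halfSpace_im_gt 0
  have hopen : IsOpen {z : ℂ | 0 < z.im} := isOpen_lt continuous_const Complex.continuous_im
  obtain ⟨Φ, hΦ'⟩ := hconv.exists_forall_hasDerivWithinAt hg
  have hΦ : ∀ z : ℂ, 0 < z.im → HasDerivAt Φ (g z) z := fun z hz =>
    (hΦ' z hz).hasDerivAt (hopen.mem_nhds hz)
  have him : ∀ z : ℂ, 0 < z.im → 0 < (-1 / z).im := fun z hz => by
    have hn : 0 < normSq z := normSq_pos.mpr (by rintro rfl; simp at hz)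
    have : (-1 / z).im = z.im / normSq z := by
      simp [Complex.div_im]; ring
    rw [this]; positivity
  have hconst : ∀ D : ℂ → ℂ, (∀ z : ℂ, 0 < z.im → HasDerivAt D 0 z) →
      ∀ z w : ℂ, 0 < z.im → 0 < w.im → D z = D w := fun D hD z w hz hw => by
    refine hconv.is_const_of_fderivWithin_eq_zero (𝕜 := ℂ) (f := D)
      (fun z hz => (hD z hz).differentiableAt.differentiableWithinAt) (fun z hz => ?_) hz hw
    rw [fderivWithin_of_isOpen hopen hz]
    have := (hD z hz).hasFDerivAt.fderiv
    rw [this]; ext; simp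
  have h1 : ∀ z w : ℂ, 0 < z.im → 0 < w.im →
      Φ (-1 / z) - Φ z = Φ (-1 / w) - Φ w := by
    refine hconst (fun z => Φ (-1 / z) - Φ z) fun z hz => ?_
    have hz0 : z ≠ 0 := by rintro rfl; simp at hz
    have e1 : HasDerivAt (fun z : ℂ => -1 / z) (1 / z ^ 2) z := by
      have := ((hasDerivAt_inv hz0).neg).congr_deriv (g' := 1 / z ^ 2) (by simp)
      refine this.congr_of_eventuallyEq (Eventually.of_forall fun w => ?_)
      simp [neg_div]
    have e2 := (hΦ _ (him z hz)).comp z e1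
    have e3 := e2.sub (hΦ z hz)
    refine e3.congr_deriv ?_
    rw [hS z hz]; field_simp; ring
  have h2 : ∀ z w : ℂ, 0 < z.im → 0 < w.im →
      Φ (z + 1) - Φ z = Φ (w + 1) - Φ w := by
    refine hconst (fun z => Φ (z + 1) - Φ z) fun z hz => ?_
    have e2 := (hΦ (z + 1) (by simpa using hz)).comp_add_const z 1
    have e3 := e2.sub (hΦ z hz)
    refine e3.congr_deriv ?_
    rw [hT z hz]; ring
  set ρ : ℂ := ⟨-1 / 2, √3 / 2⟩ with hρ
  have hρim : 0 < ρ.im := by simp [hρ]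
  have hρS : -1 / ρ = ρ + 1 := by
    have h0 : ρ ≠ 0 := by intro h; rw [h] at hρim; simp at hρim
    have h3 : (√3 : ℝ) * √3 = 3 := Real.mul_self_sqrt (by norm_num)
    rw [div_eq_iff h0]
    apply Complex.ext <;> simp [hρ] <;> nlinarith
  have hρ0 : Φ (ρ + 1) - Φ ρ = 0 := by
    rw [← hρS, h1 ρ Complex.I hρim (by simp)]
    simp [neg_div]
  have key : ∫ x in (0 : ℝ)..1, g (x + y * Complex.I) = Φ (1 + y * Complex.I) - Φ (y * Complex.I) := by
    have hd : ∀ x ∈ Set.uIcc (0 : ℝ) 1, HasDerivAt (fun x : ℝ => Φ (x + y * Complex.I)) (g (x + y * Complex.I)) x :=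
      fun x _ => by
        have h := (hΦ (x + y * Complex.I) (by simpa using hy)).comp_add_const (x : ℂ) (y * Complex.I)
        exact h.comp_ofReal
    have := intervalIntegral.integral_eq_sub_of_hasDerivAt hd ?_
    · simpa using this
    · apply ContinuousOn.intervalIntegrable
      refine hg.continuousOn.comp (by fun_prop) fun x _ => by simpa using hy
  rw [key, add_comm (1 : ℂ), h2 (y * Complex.I) ρ (by simpa using hy) hρim, hρ0]

open scoped ModularForm in
lemma tendsto_integral_of_weight_two {m : ℕ} [NeZero m] {h : ℍ → ℂ} (hh : MDiff h)
    (hΓ : ∀ γ ∈ Gamma0 m, ∀ τ : ℍ, h (γ • τ) = denomC γ τ ^ 2 * h τ)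
    (hc : ∀ γ : SL(2, ℤ), γ ∉ Gamma0 m →
      Tendsto (fun τ : ℍ => ‖h (γ • τ)‖ / ‖denomC γ τ‖ ^ 2) (comap UpperHalfPlane.im atTop) (𝓝 0)) :
    Tendsto (fun y : ℝ => ∫ x in (0 : ℝ)..1, h (UpperHalfPlane.ofComplex (x + y * Complex.I))) atTop
      (𝓝 0) := by
  classical
  have hsl : ∀ γ ∈ Gamma0 m, h ∣[(2 : ℤ)] γ = h := fun γ hγ => by
    ext τ
    rw [ModularForm.SL_slash_apply, hΓ γ hγ τ]
    rw [denom_eq_denomC]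
    have h0 := denomC_ne_zero γ τ
    field_simp
  let Q : SL(2, ℤ) ⧸ Gamma0 m → (ℍ → ℂ) := Quotient.lift (fun g => h ∣[(2 : ℤ)] g⁻¹) (by
    intro g g' hgg
    have := QuotientGroup.leftRel_apply.mp hgg
    have e : h ∣[(2 : ℤ)] (g⁻¹ * g') = h := hsl _ this
    calc h ∣[(2 : ℤ)] g⁻¹ = (h ∣[(2 : ℤ)] (g⁻¹ * g')) ∣[(2 : ℤ)] g'⁻¹ := by
          rw [← SlashAction.slash_mul]; simp
      _ = _ := by rw [e])
  have hQ : ∀ (γ : SL(2, ℤ)) q, Q q ∣[(2 : ℤ)] γ = Q (γ⁻¹ • q) := by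
    intro γ q
    induction q using QuotientGroup.induction_on with
    | H g => 
      change (h ∣[(2 : ℤ)] g⁻¹) ∣[(2 : ℤ)] γ = h ∣[(2 : ℤ)] (γ⁻¹ * g)⁻¹
      rw [← SlashAction.slash_mul]; simp
  have : Fintype (SL(2, ℤ) ⧸ Gamma0 m) := Fintype.ofFinite _
  let G : ℍ → ℂ := ∑ q, Q q
  have hG : ∀ γ : SL(2, ℤ), G ∣[(2 : ℤ)] γ = G := fun γ => by
    simp only [G, SlashAction.sum_slash, hQ]
    exact Fintype.sum_equiv (MulAction.toPerm γ⁻¹) _ _ fun q => rfl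
  have hQhol : ∀ q, MDiff (Q q) := fun q => by
    induction q using QuotientGroup.induction_on with
    | H g => exact hh.slash 2 _
  have hQcont : ∀ (q) (y : ℝ), 0 < y → IntervalIntegrable
      (fun x : ℝ => Q q (UpperHalfPlane.ofComplex (x + y * Complex.I))) MeasureTheory.volume 0 1 :=
    fun q y hy => by
      apply ContinuousOn.intervalIntegrable
      have := (UpperHalfPlane.mdifferentiable_iff.mp (hQhol q)).continuousOn
      exact this.comp (f := fun x : ℝ => (x + y * Complex.I : ℂ)) (by fun_prop)
        fun x _ => by simpa using hy
  have hG0 : ∀ y : ℝ, 0 < y →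
      ∫ x in (0 : ℝ)..1, G (UpperHalfPlane.ofComplex (x + y * Complex.I)) = 0 := fun y hy => by
    refine integral_eq_zero_of_weight_two (g := G ∘ UpperHalfPlane.ofComplex) ?_ ?_ ?_ hy
    · have e : G ∘ UpperHalfPlane.ofComplex = ∑ q, Q q ∘ UpperHalfPlane.ofComplex := by
        ext z; simp [G]
      rw [e]
      exact DifferentiableOn.sum fun q _ => UpperHalfPlane.mdifferentiable_iff.mp (hQhol q)
    · intro z hz
      have h1 := congrFun (hG ModularGroup.T) (UpperHalfPlane.ofComplex z)
      rw [ModularForm.SL_slash_apply] at h1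
      simp only [Function.comp]
      rw [← h1]
      have e : UpperHalfPlane.ofComplex (z + 1) = ModularGroup.T • UpperHalfPlane.ofComplex z := by
        ext
        rw [coe_T_smul, UpperHalfPlane.ofComplex_apply_of_im_pos hz,
          UpperHalfPlane.ofComplex_apply_of_im_pos (by simpa using hz)]
      rw [e, denom_eq_denomC]
      simp
    · intro z hz
      have h1 := congrFun (hG ModularGroup.S) (UpperHalfPlane.ofComplex z)
      rw [ModularForm.SL_slash_apply] at h1
      simp only [Function.comp]
      rw [← h1]
      have hz0 : z ≠ 0 := by rintro rfl; simp at hz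
      have e : UpperHalfPlane.ofComplex (-1 / z) = ModularGroup.S • UpperHalfPlane.ofComplex z := by
        have : (-1 / z) = ((ModularGroup.S • UpperHalfPlane.ofComplex z : ℍ) : ℂ) := by
          rw [coe_S_smul, UpperHalfPlane.ofComplex_apply_of_im_pos hz]
        rw [this, UpperHalfPlane.ofComplex_apply]
      rw [e, denom_eq_denomC, denomC_S, UpperHalfPlane.ofComplex_apply_of_im_pos hz]
      simp
      field_simp
  have hQ1 : Q (1 : SL(2, ℤ)) = h := by
    change h ∣[(2 : ℤ)] (1 : SL(2, ℤ))⁻¹ = h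
    simp
  have hQ0 : ∀ q, q ≠ ((1 : SL(2, ℤ)) : SL(2, ℤ) ⧸ Gamma0 m) → Tendsto (fun y : ℝ =>
      ∫ x in (0 : ℝ)..1, Q q (UpperHalfPlane.ofComplex (x + y * Complex.I))) atTop (𝓝 0) := by
    intro q hq
    induction q using QuotientGroup.induction_on with
    | H g =>
    have hg : g⁻¹ ∉ Gamma0 m := fun hg => hq (by
      rw [eq_comm, QuotientGroup.eq]; simpa using hg)
    have h1 := hc _ hg
    rw [Metric.tendsto_nhds] at h1 ⊢
    intro ε hε
    obtain ⟨Y, hY⟩ := (Filter.eventually_comap.mp (h1 (ε / 2) (by positivity))).exists_forall_of_atTop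
    filter_upwards [Ioi_mem_atTop 0, Ioi_mem_atTop Y] with y hy hyY
    rw [dist_zero_right]
    refine lt_of_le_of_lt (intervalIntegral.norm_integral_le_of_norm_le_const (C := ε / 2) ?_) ?_
    · intro x _
      have hpos : 0 < ((x : ℂ) + y * Complex.I).im := by simpa using hy
      have h2 := hY y hyY.le (UpperHalfPlane.ofComplex (x + y * Complex.I)) (by
        rw [UpperHalfPlane.ofComplex_apply_of_im_pos hpos]; simp)
      change ‖(h ∣[(2 : ℤ)] g⁻¹) _‖ ≤ _
      rw [ModularForm.SL_slash_apply]
      rw [dist_zero_right] at h2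
      refine le_trans (le_of_eq ?_) h2.le
      rw [denom_eq_denomC, norm_div, norm_mul, norm_norm, norm_pow, norm_norm, _root_.zpow_neg, norm_inv,
        norm_zpow]
      rfl
    · simp; linarith
  have hsum : ∀ᶠ y : ℝ in atTop, -∑ q ∈ Finset.univ.erase ((1 : SL(2, ℤ)) : SL(2, ℤ) ⧸ Gamma0 m),
      ∫ x in (0 : ℝ)..1, Q q (UpperHalfPlane.ofComplex (x + y * Complex.I)) =
      ∫ x in (0 : ℝ)..1, h (UpperHalfPlane.ofComplex (x + y * Complex.I)) := by
    filter_upwards [Ioi_mem_atTop 0] with y hy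
    have e := hG0 y hy
    simp only [G, Finset.sum_apply] at e
    rw [intervalIntegral.integral_finsetSum fun q _ => hQcont q y hy,
      ← Finset.add_sum_erase _ _ (Finset.mem_univ ((1 : SL(2, ℤ)) : SL(2, ℤ) ⧸ Gamma0 m)),
      hQ1] at e
    linear_combination -e
  refine Tendsto.congr' hsum ?_
  have := (tendsto_finsetSum (Finset.univ.erase ((1 : SL(2, ℤ)) : SL(2, ℤ) ⧸ Gamma0 m))
    fun q hq => hQ0 q (Finset.ne_of_mem_erase hq)).neg
  simpa using this

/-- The fourth powers (up to sign) of the three theta constants, indexed by the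
nonzero row vectors `(c, d)` over `ℤ/2`. -/
def thetaTwo (τ : ℂ) : ℂ := cexp (π * Complex.I * τ / 4) * jacobiTheta₂ (τ / 2) τ

def thetaQuart (c d : ZMod 2) (τ : ℂ) : ℂ :=
  if c = 0 then thetaTwo τ ^ 4
  else if d = 0 then jacobiTheta₂ (1 / 2) τ ^ 4 else -jacobiTheta₂ 0 τ ^ 4

def permSign (a b c d : ZMod 2) : ℂ := if a + d = 1 ∨ (b = 0 ∧ c = 0) then 1 else -1

lemma exp_pi_mul_int_sq (n : ℤ) :
    cexp (π * Complex.I * n ^ 2) = cexp (π * Complex.I * n) := by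
  obtain ⟨k, hk⟩ := Int.even_mul_succ_self (n - 1)
  rw [Complex.exp_eq_exp_iff_exists_int]
  refine ⟨k, ?_⟩
  have : (n : ℂ) ^ 2 = n + 2 * k := by
    have : n ^ 2 = n + 2 * k := by linear_combination hk
    exact_mod_cast this
  rw [this]; ring

lemma jacobiTheta₂_zero_add_one (τ : ℂ) : jacobiTheta₂ 0 (τ + 1) = jacobiTheta₂ (1 / 2) τ := by
  refine tsum_congr fun n => ?_
  rw [jacobiTheta₂_term, jacobiTheta₂_term]
  have : (2 * π * Complex.I * n * 0 + π * Complex.I * n ^ 2 * (τ + 1) : ℂ) =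
    π * Complex.I * n ^ 2 * τ + π * Complex.I * n ^ 2 := by ring
  rw [this, Complex.exp_add, exp_pi_mul_int_sq, ← Complex.exp_add]
  congr 1; ring

lemma jacobiTheta₂_half_add_one (τ : ℂ) : jacobiTheta₂ (1 / 2) (τ + 1) = jacobiTheta₂ 0 τ := by
  rw [← jacobiTheta₂_zero_add_one, add_assoc, one_add_one_eq_two, jacobiTheta₂_add_right]

lemma thetaTwo_add_one (τ : ℂ) :
    thetaTwo (τ + 1) = cexp (π * Complex.I / 4) * thetaTwo τ := by
  rw [thetaTwo, thetaTwo]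
  have : jacobiTheta₂ ((τ + 1) / 2) (τ + 1) = jacobiTheta₂ (τ / 2) τ := by
    refine tsum_congr fun n => ?_
    rw [jacobiTheta₂_term, jacobiTheta₂_term]
    have : (2 * π * Complex.I * n * ((τ + 1) / 2) + π * Complex.I * n ^ 2 * (τ + 1) : ℂ) =
      2 * π * Complex.I * n * (τ / 2) + π * Complex.I * n ^ 2 * τ + π * Complex.I * n +
        π * Complex.I * n ^ 2 := by ring
    rw [this, Complex.exp_add _ (π * Complex.I * n ^ 2), exp_pi_mul_int_sq, ← Complex.exp_add,
      Complex.exp_eq_exp_iff_exists_int]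
    exact ⟨n, by ring⟩
  rw [this, ← mul_assoc, ← Complex.exp_add]
  congr 2; ring

lemma exp_pi_I_quarter_pow_four : cexp (π * Complex.I / 4) ^ 4 = -1 := by
  rw [← Complex.exp_nat_mul, ← Complex.exp_pi_mul_I]; congr 1; push_cast; ring

lemma thetaQuart_add_one (c d : ZMod 2) (h : ¬(c = 0 ∧ d = 0)) (τ : ℂ) :
    thetaQuart c d (τ + 1) = -thetaQuart c (c + d) τ := by
  have : ∀ x : ZMod 2, x = 0 ∨ x = 1 := by decide
  rcases this c with rfl | rfl <;> rcases this d with rfl | rfl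
  · simp at h
  · simp only [thetaQuart, if_pos, thetaTwo_add_one, mul_pow, exp_pi_I_quarter_pow_four]; ring
  · have : (1 + 0 : ZMod 2) ≠ 0 := by decide
    simp [thetaQuart, jacobiTheta₂_half_add_one, -one_div]
  · have : (1 + 1 : ZMod 2) = 0 := by decide
    simp [thetaQuart, jacobiTheta₂_zero_add_one, this, -one_div]

lemma neg_I_mul_cpow_half_pow_four (τ : ℂ) :
    ((-Complex.I * τ) ^ (1 / 2 : ℂ)) ^ 4 = -τ ^ 2 := by
  rw [← Complex.cpow_nat_mul]
  have : ((4 : ℕ) * (1 / 2 : ℂ)) = (2 : ℕ) := by norm_num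
  rw [this, Complex.cpow_natCast, mul_pow]; simp

lemma jacobiTheta₂_zero_S {τ : ℂ} (hτ : τ ≠ 0) :
    jacobiTheta₂ 0 (-1 / τ) ^ 4 = -τ ^ 2 * jacobiTheta₂ 0 τ ^ 4 := by
  have h := jacobiTheta₂_functional_equation 0 τ
  have h0 := neg_I_mul_cpow_half_pow_four τ
  rw [h]
  simp only [mul_pow, div_pow, h0]
  simp
  field_simp

lemma jacobiTheta₂_half_S {τ : ℂ} (hτ : τ ≠ 0) :
    thetaTwo (-1 / τ) ^ 4 = -τ ^ 2 * jacobiTheta₂ (1 / 2) τ ^ 4 := by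
  have h := jacobiTheta₂_functional_equation (1 / 2) τ
  have h0 := neg_I_mul_cpow_half_pow_four τ
  rw [h, thetaTwo]
  have e : (-1 / τ / 2) = -(1 / 2 / τ) := by field_simp
  simp only [mul_pow, div_pow _ _ 4, h0]
  rw [e, jacobiTheta₂_neg_left]
  have e2 : (-π * Complex.I * (1 / 2) ^ 2 / τ : ℂ) = π * Complex.I * (-1 / τ) / 4 := by
    field_simp; ring
  rw [e2]
  field_simp

lemma thetaTwo_S {τ : ℂ} (hτ : τ ≠ 0) :
    jacobiTheta₂ (1 / 2) (-1 / τ) ^ 4 = -τ ^ 2 * thetaTwo τ ^ 4 := by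
  have hτ' : -1 / τ ≠ 0 := by simp [hτ]
  have h := jacobiTheta₂_half_S hτ'
  have : -1 / (-1 / τ) = τ := by field_simp
  rw [this] at h
  rw [h]; field_simp

lemma thetaQuart_S (c d : ZMod 2) (h : ¬(c = 0 ∧ d = 0)) {τ : ℂ} (hτ : τ ≠ 0) :
    thetaQuart c d (-1 / τ) = -τ ^ 2 * thetaQuart d c τ := by
  have : ∀ x : ZMod 2, x = 0 ∨ x = 1 := by decide
  rcases this c with rfl | rfl <;> rcases this d with rfl | rfl
  · simp at h
  · simp [thetaQuart, jacobiTheta₂_half_S hτ, -one_div]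
  · simp [thetaQuart, thetaTwo_S hτ, -one_div]
  · simp [thetaQuart, jacobiTheta₂_zero_S hτ, -one_div]

lemma permSign_mul : ∀ a b c d a' b' c' d' : ZMod 2, a * d - b * c = 1 → a' * d' - b' * c' = 1 →
    permSign (a * a' + b * c') (a * b' + b * d') (c * a' + d * c') (c * b' + d * d') =
    permSign a b c d * permSign a' b' c' d' := by
  have key : ∀ a b c d a' b' c' d' : ZMod 2, a * d - b * c = 1 → a' * d' - b' * c' = 1 →
      (((a * a' + b * c') + (c * b' + d * d') = 1 ∨
        ((a * b' + b * d') = 0 ∧ (c * a' + d * c') = 0)) ↔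
      ((a + d = 1 ∨ (b = 0 ∧ c = 0)) ↔ (a' + d' = 1 ∨ (b' = 0 ∧ c' = 0)))) := by decide
  intro a b c d a' b' c' d' h h'
  have := key a b c d a' b' c' d' h h'
  unfold permSign
  simp only [this]
  split_ifs <;> simp_all

/-- The transformation law of `thetaQuart` under `γ`. -/
def ThetaLaw (γ : SL(2, ℤ)) : Prop :=
  ∀ (c d : ZMod 2), ¬(c = 0 ∧ d = 0) → ∀ τ : ℍ, thetaQuart c d (γ • τ : ℍ) =
    permSign (γ 0 0 : ℤ) (γ 0 1 : ℤ) (γ 1 0 : ℤ) (γ 1 1 : ℤ) * denomC γ τ ^ 2 *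
    thetaQuart (c * (γ 0 0 : ℤ) + d * (γ 1 0 : ℤ)) (c * (γ 0 1 : ℤ) + d * (γ 1 1 : ℤ)) τ

lemma SL_det (γ : SL(2, ℤ)) : γ 0 0 * γ 1 1 - γ 0 1 * γ 1 0 = 1 := by
  have := γ.det_coe; rwa [Matrix.det_fin_two] at this

lemma SL_mul_apply (γ γ' : SL(2, ℤ)) (i j : Fin 2) :
    (γ * γ') i j = γ i 0 * γ' 0 j + γ i 1 * γ' 1 j := by
  have : ((γ : Matrix (Fin 2) (Fin 2) ℤ) * γ') i j = _ := Matrix.mul_apply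
  rw [Fin.sum_univ_two] at this
  exact this

lemma SL_det_zmod (γ : SL(2, ℤ)) :
    ((γ 0 0 : ℤ) : ZMod 2) * (γ 1 1 : ℤ) - (γ 0 1 : ℤ) * (γ 1 0 : ℤ) = 1 := by
  exact_mod_cast congrArg (Int.cast : ℤ → ZMod 2) (SL_det γ)

lemma ThetaLaw.mul {γ γ' : SL(2, ℤ)} (h : ThetaLaw γ) (h' : ThetaLaw γ') : ThetaLaw (γ * γ') := by
  intro c d hcd τ
  have hcd' : ¬(c * (γ 0 0 : ℤ) + d * (γ 1 0 : ℤ) = 0 ∧ c * (γ 0 1 : ℤ) + d * (γ 1 1 : ℤ) = 0) := by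
    have := SL_det_zmod γ
    generalize ((γ 0 0 : ℤ) : ZMod 2) = x at *
    generalize ((γ 0 1 : ℤ) : ZMod 2) = y at *
    generalize ((γ 1 0 : ℤ) : ZMod 2) = z at *
    generalize ((γ 1 1 : ℤ) : ZMod 2) = w at *
    revert this hcd
    revert x y z w c d
    decide
  rw [mul_smul, h c d hcd, h' _ _ hcd', denomC_mul]
  simp only [SL_mul_apply, Int.cast_add, Int.cast_mul]
  rw [permSign_mul _ _ _ _ _ _ _ _ (SL_det_zmod γ) (SL_det_zmod γ')]
  ring_nf

lemma thetaLaw_one : ThetaLaw 1 := by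
  intro c d _ τ
  simp [permSign]

lemma thetaLaw_T : ThetaLaw ModularGroup.T := by
  intro c d h τ
  rw [coe_T_smul, thetaQuart_add_one c d h]
  have : (1 + 1 : ZMod 2) = 0 := by decide
  simp [permSign, ModularGroup.coe_T, this]

lemma thetaLaw_S : ThetaLaw ModularGroup.S := by
  intro c d h τ
  rw [coe_S_smul, thetaQuart_S c d h (UpperHalfPlane.ne_zero τ)]
  have : ∀ c : ZMod 2, -c = c := by decide
  simp [permSign, ModularGroup.coe_S, this]

lemma thetaLaw_T_inv : ThetaLaw ModularGroup.T⁻¹ := by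
  intro c d h τ
  have h2 : ∀ c : ZMod 2, -c = c := by decide
  have h3 : ∀ c d : ZMod 2, c + (c + d) = d := by decide
  have h4 : ¬(c = 0 ∧ c + d = 0) := by revert c d; decide
  have e : ((ModularGroup.T⁻¹ • τ : ℍ) : ℂ) + 1 = τ := by
    rw [← coe_T_smul, ← mul_smul]; simp
  have := thetaQuart_add_one c (c + d) h4 ((ModularGroup.T⁻¹ • τ : ℍ) : ℂ)
  rw [e, h3] at this
  have h11 : (1 + 1 : ZMod 2) = 0 := by decide
  have hden : denomC ModularGroup.T⁻¹ τ = 1 := by simp [denomC]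
  simp [hden, permSign, h2, h11, this]

lemma thetaLaw (γ : SL(2, ℤ)) : ThetaLaw γ := by
  have hγ : γ ∈ Subgroup.closure ({ModularGroup.S, ModularGroup.T} : Set SL(2, ℤ)) := by
    rw [SpecialLinearGroup.SL2Z_generators]; trivial
  induction hγ using Subgroup.closure_induction'' with
  | mem x hx =>
    rcases hx with rfl | rfl
    exacts [thetaLaw_S, thetaLaw_T]
  | inv_mem x hx =>
    rcases hx with rfl | rfl
    · have : ModularGroup.S⁻¹ = (ModularGroup.S * ModularGroup.S * ModularGroup.S : SL(2, ℤ)) := by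
        decide
      rw [this]
      exact (thetaLaw_S.mul thetaLaw_S).mul thetaLaw_S
    · exact thetaLaw_T_inv
  | one => exact thetaLaw_one
  | mul x y _ _ hx hy => exact hx.mul hy

/-- `g(τ) = Σ_{n ≥ 0} φ_n qⁿ` on the upper half-plane. -/
def QSeries (g : ℍ → ℂ) (φ : PowerSeries ℂ) : Prop :=
  ∀ τ : ℍ, HasSum (fun n : ℕ => φ.coeff n * Function.Periodic.qParam 1 τ ^ n) (g τ)

lemma QSeries.exists_hasFPowerSeriesOnBall {g : ℍ → ℂ} {φ : PowerSeries ℂ} (h : QSeries g φ) :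
    ∃ F : ℂ → ℂ, HasFPowerSeriesOnBall F (.ofScalars ℂ fun n => φ.coeff n) 0 1 ∧
      ∀ τ : ℍ, g τ = F (Function.Periodic.qParam 1 τ) := by
  have key : ∀ q : ℂ, ‖q‖ < 1 → q ≠ 0 → Summable fun n => φ.coeff n * q ^ n := by
    intro q hq hq1
    have h1 := Function.Periodic.im_invQParam_pos_of_norm_lt_one one_pos hq hq1
    have := (h ⟨_, h1⟩).summable
    simpa [Function.Periodic.qParam_right_inv one_ne_zero hq1] using this
  refine ⟨(FormalMultilinearSeries.ofScalars ℂ fun n => φ.coeff n).sum, ?_, ?_⟩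
  · have hr : 1 ≤ (FormalMultilinearSeries.ofScalars ℂ (fun n => φ.coeff n) :
        FormalMultilinearSeries ℂ ℂ ℂ).radius := by
      refine le_of_forall_lt_imp_le_of_dense fun r hr ↦ ?_
      rcases eq_or_ne r 0 with rfl | hr'
      · simp
      · lift r to NNReal using hr.ne_top
        let : FiniteDimensional ℝ ℂ := basisOneI.finiteDimensional_of_finite
        apply FormalMultilinearSeries.le_radius_of_summable
        simpa [smul_eq_mul, norm_mul, mul_comm, mul_left_comm, mul_assoc] using
          (key r (by simpa using hr) (mod_cast hr')).norm
    exact (FormalMultilinearSeries.hasFPowerSeriesOnBall _ (one_pos.trans_le hr)).mono one_pos hr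
  · intro τ
    rw [FormalMultilinearSeries.sum, ← (h τ).tsum_eq]
    refine tsum_congr fun n => ?_
    simp [mul_comm]

lemma QSeries.mdifferentiable {g : ℍ → ℂ} {φ : PowerSeries ℂ} (h : QSeries g φ) :
    MDifferentiable 𝓘(ℂ) 𝓘(ℂ) g := by
  obtain ⟨F, hF, hg⟩ := h.exists_hasFPowerSeriesOnBall
  intro τ
  rw [UpperHalfPlane.mdifferentiableAt_iff]
  have h1 : DifferentiableAt ℂ F (Function.Periodic.qParam 1 τ) := by
    have := hF.differentiableOn.differentiableAt (x := Function.Periodic.qParam 1 τ)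
      (Metric.isOpen_eball.mem_nhds ?_)
    · exact this
    · simpa [Metric.mem_eball, edist_zero_right, ← ofReal_norm] using
        Function.Periodic.norm_qParam_lt_one one_pos τ.im_pos
  have h2 : DifferentiableAt ℂ (fun z => F (Function.Periodic.qParam 1 z)) (τ : ℂ) :=
    DifferentiableAt.comp (τ : ℂ) h1 (Function.Periodic.differentiable_qParam.differentiableAt)
  refine h2.congr_of_eventuallyEq ?_
  filter_upwards [UpperHalfPlane.isOpen_upperHalfPlaneSet.mem_nhds τ.im_pos] with z hz
  have := hg ⟨z, hz⟩
  simp [UpperHalfPlane.ofComplex_apply_of_im_pos hz, this]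

lemma QSeries.tendsto {g : ℍ → ℂ} {φ : PowerSeries ℂ} (h : QSeries g φ) :
    Tendsto g atImInfty (𝓝 (φ.coeff 0)) := by
  obtain ⟨F, hF, hg⟩ := h.exists_hasFPowerSeriesOnBall
  have h0 : F 0 = φ.coeff 0 := by
    have := hF.hasFPowerSeriesAt.coeff_zero (fun _ => 0)
    simpa using this.symm
  have := hF.hasFPowerSeriesAt.continuousAt.tendsto.comp
    (UpperHalfPlane.qParam_tendsto_atImInfty one_pos)
  rw [h0] at this
  exact this.congr fun τ => (hg τ).symm

lemma QSeries.unique {g : ℍ → ℂ} {φ ψ : PowerSeries ℂ} (h : QSeries g φ) (h' : QSeries g ψ) :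
    φ = ψ := by
  obtain ⟨F, hF, hg⟩ := h.exists_hasFPowerSeriesOnBall
  obtain ⟨G, hG, hg'⟩ := h'.exists_hasFPowerSeriesOnBall
  have hFG : F =ᶠ[𝓝 0] G := by
    rw [← hF.hasFPowerSeriesAt.continuousAt.eventuallyEq_nhds_iff_eventuallyEq_nhdsNE
      hG.hasFPowerSeriesAt.continuousAt]
    filter_upwards [self_mem_nhdsWithin, nhdsWithin_le_nhds (Metric.ball_mem_nhds 0 one_pos)]
      with q hq1 hq
    have h1 := Function.Periodic.im_invQParam_pos_of_norm_lt_one one_pos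
      (by simpa using hq) hq1
    have := (hg ⟨_, h1⟩).symm.trans (hg' ⟨_, h1⟩)
    simpa [Function.Periodic.qParam_right_inv one_ne_zero hq1] using this
  have := hF.hasFPowerSeriesAt.eq_formalMultilinearSeries
    (hG.hasFPowerSeriesAt.congr hFG.symm)
  ext n
  have := congrArg (fun p => p.coeff n) this
  simpa [FormalMultilinearSeries.coeff_ofScalars] using this

lemma QSeries.congr {g g' : ℍ → ℂ} {φ : PowerSeries ℂ} (h : QSeries g φ) (hg : ∀ τ, g' τ = g τ) :
    QSeries g' φ := fun τ => by rw [hg]; exact h τ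

lemma QSeries.const (c : ℂ) : QSeries (fun _ => c) (PowerSeries.C c) := by
  intro τ
  convert hasSum_ite_eq 0 c using 2 with n
  rw [PowerSeries.coeff_C]
  split_ifs with h <;> simp [h]

lemma QSeries.one : QSeries (fun _ => 1) 1 := by
  simpa using QSeries.const 1

lemma QSeries.q : QSeries (fun τ => Function.Periodic.qParam 1 τ) PowerSeries.X := by
  intro τ
  convert hasSum_ite_eq 1 (Function.Periodic.qParam 1 τ) using 2 with n
  rw [PowerSeries.coeff_X]
  split_ifs with h <;> simp [h]

lemma QSeries.add {g g' : ℍ → ℂ} {φ ψ : PowerSeries ℂ} (h : QSeries g φ) (h' : QSeries g' ψ) :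
    QSeries (fun τ => g τ + g' τ) (φ + ψ) := fun τ => by
  simpa [add_mul] using (h τ).add (h' τ)

lemma QSeries.mul {g g' : ℍ → ℂ} {φ ψ : PowerSeries ℂ} (h : QSeries g φ) (h' : QSeries g' ψ) :
    QSeries (fun τ => g τ * g' τ) (φ * ψ) := fun τ => by
  have h1 := (h τ).summable.norm
  have h2 := (h' τ).summable.norm
  have h3 := (summable_norm_sum_mul_antidiagonal_of_summable_norm h1 h2).of_norm.hasSum
  rw [← tsum_mul_tsum_eq_tsum_sum_antidiagonal_of_summable_norm h1 h2, (h τ).tsum_eq,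
    (h' τ).tsum_eq] at h3
  rw [show (fun n => (PowerSeries.coeff n) (φ * ψ) * Function.Periodic.qParam 1 (τ : ℂ) ^ n) = _
    from funext fun n => ?_]
  · exact h3
  rw [PowerSeries.coeff_mul, Finset.sum_mul]
  refine Finset.sum_congr rfl fun x hx => ?_
  rw [← Finset.HasAntidiagonal.mem_antidiagonal.mp hx, pow_add]
  ring

lemma QSeries.pow {g : ℍ → ℂ} {φ : PowerSeries ℂ} (h : QSeries g φ) (n : ℕ) :
    QSeries (fun τ => g τ ^ n) (φ ^ n) := by
  induction n with
  | zero => simpa using QSeries.one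
  | succ n ih => simpa [pow_succ] using ih.mul h

lemma HasSum.of_eq {f g : ℕ → ℂ} {s : ℂ} (h : HasSum f s) (hfg : ∀ n, g n = f n) : HasSum g s :=
  (funext hfg : g = f) ▸ h

/-- The power series `Σ_k X^{e(k)}` for an injective `e`. -/
def sparseSeries (e : ℕ → ℕ) : PowerSeries ℤ :=
  open Classical in .mk fun n => if n ∈ Set.range e then 1 else 0

lemma QSeries.sparse {e : ℕ → ℕ} (he : Function.Injective e) {g : ℍ → ℂ}
    (h : ∀ τ : ℍ, HasSum (fun k => Function.Periodic.qParam 1 τ ^ e k) (g τ)) :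
    QSeries g ((sparseSeries e).map (Int.castRingHom ℂ)) := by
  intro τ
  rw [← he.hasSum_iff]
  · convert h τ using 2 with k
    simp [sparseSeries]
  · intro n hn
    simp only [sparseSeries, PowerSeries.coeff_map, PowerSeries.coeff_mk, if_neg hn]
    simp

lemma qParam_one_pow (τ : ℂ) (n : ℕ) :
    Function.Periodic.qParam 1 τ ^ n = cexp (2 * π * Complex.I * n * τ) := by
  rw [Function.Periodic.qParam, ← Complex.exp_nat_mul]
  congr 1; push_cast; ring

/-- `Σ_{n ≥ 0} q^{r n (n + 1)}`. -/
def etaSum (r : ℕ) (τ : ℍ) : ℂ := ∑' n : ℕ, Function.Periodic.qParam 1 τ ^ (r * (n * (n + 1)))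

lemma hasSum_etaSum (r : ℕ) (hr : 0 < r) (τ : ℍ) :
    HasSum (fun n : ℕ => Function.Periodic.qParam 1 τ ^ (r * (n * (n + 1)))) (etaSum r τ) := by
  have h1 : Summable fun n : ℕ => ‖Function.Periodic.qParam 1 (τ : ℂ)‖ ^ n :=
    summable_geometric_of_lt_one (norm_nonneg _)
      (Function.Periodic.norm_qParam_lt_one one_pos τ.im_pos)
  refine (Summable.of_norm_bounded h1 fun n => ?_).hasSum
  rw [norm_pow]
  refine pow_le_pow_of_le_one (norm_nonneg _)
    (Function.Periodic.norm_qParam_lt_one one_pos τ.im_pos).le ?_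
  rcases n with _ | n
  · simp
  · calc n + 1 = 1 * ((n + 1) * 1) := by ring
      _ ≤ _ := by gcongr <;> omega

lemma im_natCast_mul_pos {m : ℕ} (hm : 0 < m) (τ : ℍ) : 0 < ((m : ℂ) * τ).im := by
  have h : (m : ℂ) = ((m : ℝ) : ℂ) := by push_cast; rfl
  have := τ.im_pos
  rw [h, Complex.im_ofReal_mul]
  have : (0 : ℝ) < m := by exact_mod_cast hm
  exact mul_pos this τ.im_pos

/-- The point `mτ`. -/
def scale (m : ℕ) [NeZero m] (τ : ℍ) : ℍ := ⟨m * τ, im_natCast_mul_pos (NeZero.pos m) τ⟩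

@[simp] lemma coe_scale (m : ℕ) [NeZero m] (τ : ℍ) : (scale m τ : ℂ) = m * τ := rfl

lemma thetaTwo_eq_etaSum (r : ℕ) [NeZero r] (τ : ℍ) :
    thetaTwo (2 * r * τ) = 2 * cexp (2 * π * Complex.I * r * τ / 4) * etaSum r τ := by
  have him : 0 < (2 * r * τ : ℂ).im := by
    have := im_natCast_mul_pos (m := 2 * r) (NeZero.pos _) τ
    rwa [Nat.cast_mul] at this
  have h1 := hasSum_etaSum r (NeZero.pos r) τ
  simp only [qParam_one_pow] at h1
  have h2 : HasSum (fun n : ℤ => jacobiTheta₂_term n ((2 * r * τ : ℂ) / 2) (2 * r * τ))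
      (etaSum r τ + etaSum r τ) := by
    refine HasSum.of_nat_of_neg_add_one ?_ ?_
    · convert h1 using 2 with n
      rw [jacobiTheta₂_term]
      congr 1; push_cast; ring
    · convert h1 using 2 with n
      rw [jacobiTheta₂_term]
      congr 1; push_cast; ring
  have h3 := (hasSum_jacobiTheta₂_term ((2 * r * τ : ℂ) / 2) him).unique h2
  rw [thetaTwo, h3]
  ring_nf

lemma Theta_eq_jacobiTheta (τ : ℍ) : Theta τ = jacobiTheta (2 * τ) := by
  rw [Theta, jacobiTheta]
  refine tsum_congr fun n => ?_
  congr 1; ring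

lemma hasSum_Theta (τ : ℍ) :
    HasSum (fun n : ℕ => Function.Periodic.qParam 1 τ ^ ((n + 1) ^ 2)) ((Theta τ - 1) / 2) := by
  have him : 0 < (2 * τ : ℂ).im := im_natCast_mul_pos two_pos τ
  rw [Theta_eq_jacobiTheta]
  convert hasSum_nat_jacobiTheta him using 2 with n
  rw [qParam_one_pow]
  congr 1; push_cast; ring

/-- The integral `q`-series of `θ`. -/
def thetaSeries : PowerSeries ℤ := 1 + 2 * sparseSeries fun n => (n + 1) ^ 2

lemma QSeries.theta : QSeries Theta (thetaSeries.map (Int.castRingHom ℂ)) := by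
  have h1 : QSeries (fun τ => (Theta τ - 1) / 2) _ := QSeries.sparse (e := fun n => (n + 1) ^ 2)
    (fun a b h => by simpa using h) hasSum_Theta
  have h2 := QSeries.one.add ((QSeries.const 2).mul h1)
  have : thetaSeries.map (Int.castRingHom ℂ) = 1 + PowerSeries.C 2 *
      (sparseSeries fun n => (n + 1) ^ 2).map (Int.castRingHom ℂ) := by
    rw [thetaSeries, map_add, map_mul, map_one, map_ofNat, map_ofNat]
  rw [this]
  exact h2.congr fun τ => by ring

/-- The integral `q`-series of `Σ_{n ≥ 0} q^{r n (n + 1)}`. -/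
def etaSeries (r : ℕ) : PowerSeries ℤ := sparseSeries fun n => r * (n * (n + 1))

lemma QSeries.eta (r : ℕ) [NeZero r] :
    QSeries (etaSum r) ((etaSeries r).map (Int.castRingHom ℂ)) := by
  refine QSeries.sparse (fun a b h => ?_) (hasSum_etaSum r (NeZero.pos r))
  have h : a * (a + 1) = b * (b + 1) := Nat.eq_of_mul_eq_mul_left (NeZero.pos r) h
  nlinarith [lt_trichotomy a b]

lemma coeff_zero_sparseSeries (e : ℕ → ℕ) (he : ∃ k, e k = 0) :
    (sparseSeries e).coeff 0 = 1 := by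
  simpa [sparseSeries] using he

lemma coeff_zero_sparseSeries' (e : ℕ → ℕ) (he : ¬ ∃ k, e k = 0) :
    (sparseSeries e).coeff 0 = 0 := by
  simpa [sparseSeries] using he

lemma coeff_zero_etaSeries (r : ℕ) : (etaSeries r).coeff 0 = 1 :=
  coeff_zero_sparseSeries _ ⟨0, by simp⟩

lemma coeff_zero_thetaSeries : thetaSeries.coeff 0 = 1 := by
  have := coeff_zero_sparseSeries' (fun n => (n + 1) ^ 2) (by simp)
  rw [PowerSeries.coeff_zero_eq_constantCoeff] at *
  simp [thetaSeries, this]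

/-- `θ(4τ) = θ(τ) - 2 Σ_{m odd} q^{m²}`. -/
lemma Theta_scale_four (τ : ℍ) :
    Theta (scale 4 τ) = Theta τ - 2 * (Function.Periodic.qParam 1 τ * etaSum 4 τ) := by
  have h1 := hasSum_Theta (scale 4 τ)
  have h2 := (hasSum_etaSum 4 (by norm_num) τ).mul_left (Function.Periodic.qParam 1 (τ : ℂ))
  have h3 : HasSum (fun n : ℕ => Function.Periodic.qParam 1 τ ^ ((n + 1) ^ 2))
      (Function.Periodic.qParam 1 τ * etaSum 4 τ + (Theta (scale 4 τ) - 1) / 2) := by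
    refine HasSum.even_add_odd ?_ ?_
    · refine h2.of_eq fun n => ?_
      rw [← pow_succ']
      congr 1; ring
    · refine h1.of_eq fun n => ?_
      rw [qParam_one_pow, qParam_one_pow]
      congr 1; push_cast; simp; ring
  have := (hasSum_Theta τ).unique h3
  linear_combination -2 * this

/-- The point `τ / 2`. -/
def half (τ : ℍ) : ℍ := ⟨τ / 2, by
  have : (τ / 2 : ℂ) = ((1 / 2 : ℝ) : ℂ) * τ := by push_cast; ring
  rw [this, Complex.im_ofReal_mul]
  exact mul_pos (by norm_num) τ.im_pos⟩

@[simp] lemma coe_half (τ : ℍ) : (half τ : ℂ) = τ / 2 := rfl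

lemma im_half (τ : ℍ) : (half τ).im = τ.im / 2 := by
  change (τ / 2 : ℂ).im = _
  have : (τ / 2 : ℂ) = ((1 / 2 : ℝ) : ℂ) * τ := by push_cast; ring
  rw [this, Complex.im_ofReal_mul]
  change 1 / 2 * τ.im = τ.im / 2
  ring

lemma tendsto_half : Tendsto half atImInfty atImInfty := by
  rw [atImInfty, tendsto_comap_iff]
  have : UpperHalfPlane.im ∘ half = fun τ => τ.im / 2 := funext im_half
  rw [this]
  exact tendsto_comap.atTop_div_const two_pos

lemma thetaTwo_eq_half (τ : ℍ) :
    thetaTwo τ = 2 * cexp (2 * π * Complex.I * half τ / 4) * etaSum 1 (half τ) := by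
  have := thetaTwo_eq_etaSum 1 (half τ)
  rw [coe_half] at *
  simp only [Nat.cast_one, mul_one] at this
  rw [← this]; congr 1; ring

lemma tendsto_etaSum (r : ℕ) [NeZero r] : Tendsto (etaSum r) atImInfty (𝓝 1) := by
  have := (QSeries.eta r).tendsto
  simpa [coeff_zero_etaSeries] using this

lemma tendsto_thetaTwo : Tendsto (fun τ : ℍ => thetaTwo τ) atImInfty (𝓝 0) := by
  have h1 : Tendsto (fun τ : ℍ => cexp (2 * π * Complex.I * half τ / 4)) atImInfty (𝓝 0) := by
    have := (UpperHalfPlane.qParam_tendsto_atImInfty (h := 4) (by norm_num)).comp tendsto_half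
    refine this.congr fun τ => ?_
    simp [Function.Periodic.qParam]
  have h2 := (tendsto_etaSum 1).comp tendsto_half
  have := (h1.const_mul 2).mul h2
  simp only [mul_zero, zero_mul] at this
  exact this.congr fun τ => (thetaTwo_eq_half τ).symm

lemma tendsto_jacobiTheta₂_zero :
    Tendsto (fun τ : ℍ => jacobiTheta₂ 0 τ) atImInfty (𝓝 1) := by
  have h := QSeries.theta.tendsto.comp tendsto_half
  have : ((thetaSeries.map (Int.castRingHom ℂ)).coeff 0) = 1 := by
    simp [coeff_zero_thetaSeries]
  rw [this] at h
  refine h.congr fun τ => ?_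
  rw [Function.comp, Theta_eq_jacobiTheta, jacobiTheta_eq_jacobiTheta₂, coe_half]
  congr 1; ring

lemma tendsto_jacobiTheta₂_half :
    Tendsto (fun τ : ℍ => jacobiTheta₂ (1 / 2) τ) atImInfty (𝓝 1) := by
  have h1 : Tendsto (fun τ : ℍ => ModularGroup.T • τ) atImInfty atImInfty := by
    rw [atImInfty, tendsto_comap_iff]
    refine tendsto_comap.congr fun τ => ?_
    change τ.im = (ModularGroup.T • τ).im
    rw [im_SL_smul]; simp
  refine (tendsto_jacobiTheta₂_zero.comp h1).congr fun τ => ?_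
  rw [Function.comp, coe_T_smul, jacobiTheta₂_zero_add_one]

lemma tendsto_thetaQuart_zero (d : ZMod 2) :
    Tendsto (fun τ : ℍ => thetaQuart 0 d τ) atImInfty (𝓝 0) := by
  simpa [thetaQuart] using tendsto_thetaTwo.pow 4

lemma tendsto_norm_thetaQuart_one (d : ZMod 2) :
    Tendsto (fun τ : ℍ => ‖thetaQuart 1 d τ‖) atImInfty (𝓝 1) := by
  by_cases hd : d = 0
  · simpa [thetaQuart, hd] using (tendsto_jacobiTheta₂_half.pow 4).norm
  · simpa [thetaQuart, hd] using (tendsto_jacobiTheta₂_zero.pow 4).norm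

lemma mdifferentiable_jacobiTheta₂_affine (u v : ℂ) :
    MDifferentiable 𝓘(ℂ) 𝓘(ℂ) (fun τ : ℍ => jacobiTheta₂ (u * τ + v) τ) := by
  intro τ
  rw [UpperHalfPlane.mdifferentiableAt_iff]
  have h1 := (hasFDerivAt_jacobiTheta₂ (u * τ + v) τ.im_pos).differentiableAt
  have h2 : DifferentiableAt ℂ (fun z : ℂ => (u * z + v, z)) τ := by fun_prop
  have h3 := DifferentiableAt.comp (τ : ℂ) (f := fun z : ℂ => (u * z + v, z))
    (g := fun p : ℂ × ℂ => jacobiTheta₂ p.1 p.2) h1 h2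
  refine h3.congr_of_eventuallyEq ?_
  filter_upwards [UpperHalfPlane.isOpen_upperHalfPlaneSet.mem_nhds τ.im_pos] with z hz
  simp [UpperHalfPlane.ofComplex_apply_of_im_pos hz]

lemma mdifferentiable_of_differentiable {g : ℂ → ℂ} (hg : Differentiable ℂ g) :
    MDifferentiable 𝓘(ℂ) 𝓘(ℂ) (fun τ : ℍ => g τ) := by
  intro τ
  rw [UpperHalfPlane.mdifferentiableAt_iff]
  refine (hg (τ : ℂ)).congr_of_eventuallyEq ?_
  filter_upwards [UpperHalfPlane.isOpen_upperHalfPlaneSet.mem_nhds τ.im_pos] with z hz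
  simp [UpperHalfPlane.ofComplex_apply_of_im_pos hz]

lemma mdifferentiable_thetaTwo : MDifferentiable 𝓘(ℂ) 𝓘(ℂ) (fun τ : ℍ => thetaTwo τ) := by
  refine MDifferentiable.mul (p := fun τ : ℍ => cexp (π * Complex.I * τ / 4))
    (mdifferentiable_of_differentiable (g := fun z => cexp (π * Complex.I * z / 4))
      (by fun_prop)) ?_
  simpa [div_eq_inv_mul] using mdifferentiable_jacobiTheta₂_affine (1 / 2) 0

/-- The product of the three even theta constants, to the eighth power. -/
def thetaProd (τ : ℍ) : ℂ := (thetaQuart 0 1 τ * thetaQuart 1 0 τ * thetaQuart 1 1 τ) ^ 2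

lemma mdifferentiable_thetaProd : MDifferentiable 𝓘(ℂ) 𝓘(ℂ) thetaProd := by
  have h1 := mdifferentiable_thetaTwo
  have h2 : MDifferentiable 𝓘(ℂ) 𝓘(ℂ) (fun τ : ℍ => jacobiTheta₂ 0 τ) := by
    simpa using mdifferentiable_jacobiTheta₂_affine 0 0
  have h3 : MDifferentiable 𝓘(ℂ) 𝓘(ℂ) (fun τ : ℍ => jacobiTheta₂ (1 / 2) τ) := by
    simpa using mdifferentiable_jacobiTheta₂_affine 0 (1 / 2)
  have : thetaProd = fun τ : ℍ =>
      (thetaTwo τ ^ 4 * jacobiTheta₂ (1 / 2) τ ^ 4 * jacobiTheta₂ 0 τ ^ 4) ^ 2 := by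
    ext τ; simp [thetaProd, thetaQuart]
  rw [this]
  exact (((h1.pow 4).mul (h3.pow 4)).mul (h2.pow 4)).pow 2

lemma permSign_sq (a b c d : ZMod 2) : permSign a b c d ^ 2 = 1 := by
  rw [permSign]; split_ifs <;> norm_num

lemma thetaProd_smul (γ : SL(2, ℤ)) (τ : ℍ) :
    thetaProd (γ • τ) = denomC γ τ ^ 12 * thetaProd τ := by
  have h01 := thetaLaw γ 0 1 (by decide) τ
  have h10 := thetaLaw γ 1 0 (by decide) τ
  have h11 := thetaLaw γ 1 1 (by decide) τ
  have hs := permSign_sq (γ 0 0) (γ 0 1) (γ 1 0) (γ 1 1)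
  have hp : ∀ a b c d : ZMod 2, a * d - b * c = 1 →
      thetaQuart (0 * a + 1 * c) (0 * b + 1 * d) τ * thetaQuart (1 * a + 0 * c) (1 * b + 0 * d) τ *
        thetaQuart (1 * a + 1 * c) (1 * b + 1 * d) τ =
      thetaQuart 0 1 τ * thetaQuart 1 0 τ * thetaQuart 1 1 τ := by
    have h2 : (1 + 1 : ZMod 2) = 0 := by decide
    have : ∀ x : ZMod 2, x = 0 ∨ x = 1 := by decide
    intro a b c d h
    rcases this a with rfl | rfl <;> rcases this b with rfl | rfl <;>
    rcases this c with rfl | rfl <;> rcases this d with rfl | rfl <;>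
    first
      | (exfalso; revert h; decide)
      | (simp only [h2, zero_mul, one_mul, add_zero, zero_add]; done)
      | (simp only [h2, zero_mul, one_mul, add_zero, zero_add]; ring)
  have hdet := hp (γ 0 0) (γ 0 1) (γ 1 0) (γ 1 1) (SL_det_zmod γ)
  rw [thetaProd, h01, h10, h11, thetaProd, ← hdet]
  set s := permSign (γ 0 0) (γ 0 1) (γ 1 0) (γ 1 1)
  linear_combination (denomC γ τ ^ 12 *
      (thetaQuart (0 * (γ 0 0 : ZMod 2) + 1 * (γ 1 0 : ZMod 2))
          (0 * (γ 0 1 : ZMod 2) + 1 * (γ 1 1 : ZMod 2)) τ *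
        thetaQuart (1 * (γ 0 0 : ZMod 2) + 0 * (γ 1 0 : ZMod 2))
          (1 * (γ 0 1 : ZMod 2) + 0 * (γ 1 1 : ZMod 2)) τ *
        thetaQuart (1 * (γ 0 0 : ZMod 2) + 1 * (γ 1 0 : ZMod 2))
          (1 * (γ 0 1 : ZMod 2) + 1 * (γ 1 1 : ZMod 2)) τ) ^ 2 * (s ^ 4 + s ^ 2 + 1)) * hs

open scoped ModularForm in
lemma thetaProd_slash (γ : SL(2, ℤ)) : thetaProd ∣[(12 : ℤ)] γ = thetaProd := by
  ext τ
  rw [ModularForm.SL_slash_apply, denom_eq_denomC, thetaProd_smul]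
  have := denomC_ne_zero γ τ
  rw [_root_.zpow_neg]
  norm_cast
  field_simp

lemma tendsto_thetaProd : Tendsto thetaProd atImInfty (𝓝 0) := by
  have h := (((tendsto_thetaQuart_zero 1).norm.mul (tendsto_norm_thetaQuart_one 0)).mul
    (tendsto_norm_thetaQuart_one 1)).pow 2
  rw [tendsto_zero_iff_norm_tendsto_zero]
  simpa [thetaProd] using h

/-- `thetaProd` as a cusp form of weight `12`. -/
def thetaCusp : CuspForm 𝒮ℒ 12 where
  toFun := thetaProd
  slash_action_eq' A hA := by
    obtain ⟨A, rfl⟩ := hA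
    exact thetaProd_slash A
  holo' := mdifferentiable_thetaProd
  zero_at_cusps' hc := by
    rw [Subgroup.IsArithmetic.isCusp_iff_isCusp_SL2Z] at hc
    rw [OnePoint.isZeroAt_iff_forall_SL2Z hc]
    intro γ _
    rw [thetaProd_slash]
    exact tendsto_thetaProd

lemma thetaProd_ne_zero (τ : ℍ) : thetaProd τ ≠ 0 := by
  obtain ⟨c, hc⟩ := CuspForm.exists_smul_discriminant_of_weight_eq_twelve thetaCusp
  have hc' : ∀ τ, thetaProd τ = c * ModularForm.discriminant τ := fun τ =>
    (DFunLike.congr_fun hc τ).symm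
  have h0 : c ≠ 0 := by
    rintro rfl
    have h1 := (tendsto_etaSum 1).comp tendsto_half
    have h2 := h1.eventually_ne one_ne_zero
    have h3 := (tendsto_norm_thetaQuart_one 0).eventually_ne one_ne_zero
    have h4 := (tendsto_norm_thetaQuart_one 1).eventually_ne one_ne_zero
    obtain ⟨τ, h2, h3, h4⟩ := (h2.and (h3.and h4)).exists
    have := hc' τ
    rw [zero_mul, thetaProd] at this
    have h5 : thetaQuart 0 1 τ ≠ 0 := by
      simp only [thetaQuart, if_true, thetaTwo_eq_half]
      refine pow_ne_zero _ (mul_ne_zero (mul_ne_zero two_ne_zero (Complex.exp_ne_zero _)) h2)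
    simp only [ne_eq, norm_eq_zero] at h3 h4
    simp [h5, h3, h4] at this
  rw [hc']
  exact mul_ne_zero h0 (ModularForm.discriminant_ne_zero τ)

lemma thetaQuart_ne_zero (c d : ZMod 2) (τ : ℍ) : thetaQuart c d τ ≠ 0 := by
  have h := thetaProd_ne_zero τ
  rw [thetaProd] at h
  have h' := ne_zero_pow two_ne_zero h
  have : ∀ x : ZMod 2, x = 0 ∨ x = 1 := by decide
  simp only [mul_ne_zero_iff] at h'
  have h01 : thetaQuart 0 0 τ = thetaQuart 0 1 τ := by simp [thetaQuart]
  rcases this c with rfl | rfl <;> rcases this d with rfl | rfl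
  exacts [h01 ▸ h'.1.1, h'.1.1, h'.1.2, h'.2]

lemma exists_scale_smul_eq (m : ℕ) [NeZero m] (γ : SL(2, ℤ)) (hγ : γ ∈ Gamma0 m) :
    ∃ γ' : SL(2, ℤ), γ' 0 0 = γ 0 0 ∧ γ' 0 1 = m * γ 0 1 ∧ γ 1 0 = m * γ' 1 0 ∧
      γ' 1 1 = γ 1 1 ∧ ∀ τ, scale m (γ • τ) = γ' • scale m τ ∧
        denomC γ' (scale m τ) = denomC γ τ := by
  obtain ⟨c, hc⟩ : (m : ℤ) ∣ γ 1 0 := by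
    rw [Gamma0_mem] at hγ
    exact (ZMod.intCast_zmod_eq_zero_iff_dvd _ _).mp hγ
  have hdet := SL_det γ
  refine ⟨⟨!![γ 0 0, m * γ 0 1; c, γ 1 1], ?_⟩, ?_⟩
  · rw [Matrix.det_fin_two_of]
    linear_combination hdet + γ 0 1 * hc
  refine ⟨rfl, rfl, hc, rfl, fun τ => ?_⟩
  set γ' : SL(2, ℤ) := ⟨!![γ 0 0, m * γ 0 1; c, γ 1 1], _⟩
  have hden : denomC γ' (scale m τ) = denomC γ τ := by
    have h1 : γ' 1 0 = c := rfl
    have h2 : γ' 1 1 = γ 1 1 := rfl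
    rw [denomC, denomC, h1, h2, hc]
    push_cast [coe_scale]; ring
  refine ⟨?_, hden⟩
  ext
  rw [coe_scale, coe_SL_smul, coe_SL_smul, hden]
  have h1 : γ' 0 0 = γ 0 0 := rfl
  have h2 : γ' 0 1 = m * γ 0 1 := rfl
  rw [h1, h2, coe_scale]
  push_cast; ring

lemma Gamma0_le {m n : ℕ} (h : m ∣ n) : Gamma0 n ≤ Gamma0 m := by
  intro γ hγ
  rw [Gamma0_mem] at *
  exact (ZMod.intCast_zmod_eq_zero_iff_dvd _ _).mpr
    (dvd_trans (by exact_mod_cast h) ((ZMod.intCast_zmod_eq_zero_iff_dvd _ _).mp hγ))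

lemma thetaQuart_scale_smul (m : ℕ) [NeZero m] (hm : Even m) (γ : SL(2, ℤ))
    (hγ : γ ∈ Gamma0 (2 * m)) (c d : ZMod 2) (h : ¬(c = 0 ∧ d = 0)) (τ : ℍ) :
    thetaQuart c d (scale m (γ • τ)) = denomC γ τ ^ 2 * thetaQuart c d (scale m τ) := by
  obtain ⟨γ', h00, h01, h10, h11, hτ⟩ :=
    exists_scale_smul_eq m γ (Gamma0_le (Dvd.intro_left 2 rfl) hγ)
  have hm2 : (m : ZMod 2) = 0 := by
    obtain ⟨k, rfl⟩ := hm
    exact_mod_cast (ZMod.natCast_eq_zero_iff (k + k) 2).mpr ⟨k, by ring⟩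
  have e01 : ((γ' 0 1 : ℤ) : ZMod 2) = 0 := by rw [h01]; push_cast; rw [hm2, zero_mul]
  have e10 : ((γ' 1 0 : ℤ) : ZMod 2) = 0 := by
    rw [Gamma0_mem] at hγ
    have h1 := (ZMod.intCast_zmod_eq_zero_iff_dvd _ _).mp hγ
    refine (ZMod.intCast_zmod_eq_zero_iff_dvd _ 2).mpr ?_
    rw [h10] at h1
    push_cast at h1
    rw [mul_comm (m : ℤ)] at h1
    exact Int.dvd_of_mul_dvd_mul_right (by exact_mod_cast NeZero.ne m) h1
  have hd := SL_det_zmod γ'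
  rw [e01, e10] at hd
  obtain ⟨e00, e11⟩ : ((γ' 0 0 : ℤ) : ZMod 2) = 1 ∧ ((γ' 1 1 : ℤ) : ZMod 2) = 1 := by
    revert hd; generalize ((γ' 0 0 : ℤ) : ZMod 2) = x; generalize ((γ' 1 1 : ℤ) : ZMod 2) = y
    revert x y; decide
  rw [(hτ τ).1, thetaLaw γ' c d h, e00, e01, e10, e11, (hτ τ).2]
  simp [permSign]

lemma exists_scale_smul_eq_smul (m : ℕ) [NeZero m] (γ : SL(2, ℤ)) :
    ∃ (γ' : SL(2, ℤ)) (α δ : ℕ) (t : ℍ → ℍ), 0 < δ ∧ (α : ℤ) ∣ m ∧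
      γ 1 0 = α * γ' 1 0 ∧ m * γ 0 0 = α * γ' 0 0 ∧
      Tendsto t atImInfty atImInfty ∧ ∀ τ, scale m (γ • τ) = γ' • t τ ∧
        denomC γ τ = δ * denomC γ' (t τ) := by
  have hdet := SL_det γ
  have hm0 : (m : ℤ) ≠ 0 := by exact_mod_cast NeZero.ne m
  set α : ℕ := Int.gcd (m * γ 0 0) (γ 1 0) with hα
  have hα0 : 0 < α := by
    refine Int.gcd_pos_iff.mpr ?_
    by_contra! h
    have h0 : γ 0 0 = 0 := (mul_eq_zero.mp h.1).resolve_left hm0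
    rw [h.2, h0] at hdet
    simp at hdet
  have hα0' : (α : ℤ) ≠ 0 := by exact_mod_cast hα0.ne'
  obtain ⟨x, hx⟩ : (α : ℤ) ∣ m * γ 0 0 := Int.gcd_dvd_left ..
  obtain ⟨z, hz⟩ : (α : ℤ) ∣ γ 1 0 := Int.gcd_dvd_right ..
  have hbez : (α : ℤ) = (m * γ 0 0) * _ + γ 1 0 * _ := Int.gcd_eq_gcd_ab _ _
  generalize Int.gcdA (m * γ 0 0) (γ 1 0) = w at hbez
  generalize Int.gcdB (m * γ 0 0) (γ 1 0) = y at hbez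
  have hxz : x * w + z * y = 1 := by
    apply mul_left_cancel₀ hα0'
    linear_combination -hbez - w * hx - y * hz
  set δ : ℤ := x * γ 1 1 - z * (m * γ 0 1) with hδ
  have hαδ : α * δ = m := by
    rw [hδ]; linear_combination -γ 1 1 * hx + m * γ 0 1 * hz + m * hdet
  have hδ0 : 0 < δ := by
    have : 0 < (α : ℤ) * δ := by rw [hαδ]; exact_mod_cast NeZero.pos m
    exact pos_of_mul_pos_right this (by positivity)
  lift δ to ℕ using hδ0.le with δ'
  have hδ0 : 0 < δ' := by exact_mod_cast hδ0
  set β : ℤ := w * (m * γ 0 1) + y * γ 1 1 with hβ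
  have hαR : (0 : ℝ) < α := by exact_mod_cast hα0
  have hδR : (0 : ℝ) < δ' := by exact_mod_cast hδ0
  have him : ∀ τ : ℍ, ((α * τ + β) / δ' : ℂ).im = α / δ' * τ.im := by
    intro τ
    have : ((α * τ + β) / δ' : ℂ) = ((α / δ' : ℝ) : ℂ) * τ + ((β / δ' : ℝ) : ℂ) := by
      push_cast; ring
    rw [this, Complex.add_im, Complex.im_ofReal_mul, Complex.ofReal_im, add_zero]
    rfl
  let t : ℍ → ℍ := fun τ => ⟨(α * τ + β) / δ', by
    rw [him]; exact mul_pos (div_pos hαR hδR) τ.im_pos⟩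
  have ht : ∀ τ, (t τ : ℂ) = (α * τ + β) / δ' := fun τ => rfl
  let γ' : SL(2, ℤ) := ⟨!![x, -y; z, w], by rw [Matrix.det_fin_two_of]; linear_combination hxz⟩
  have e00 : γ' 0 0 = x := rfl
  have e01 : γ' 0 1 = -y := rfl
  have e10 : γ' 1 0 = z := rfl
  have e11 : γ' 1 1 = w := rfl
  have hδC : (δ' : ℂ) ≠ 0 := by exact_mod_cast hδ0.ne'
  have hden : ∀ τ, denomC γ τ = δ' * denomC γ' (t τ) := by
    intro τ
    rw [denomC, denomC, e10, e11, ht]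
    have h1 : z * β + w * δ' = γ 1 1 := by
      rw [hδ, hβ]; linear_combination γ 1 1 * hxz
    have h1' : (z * β + w * δ' : ℂ) = γ 1 1 := by exact_mod_cast h1
    have h2 : (γ 1 0 : ℂ) = α * z := by exact_mod_cast hz
    rw [← h1', h2]; field_simp; ring
  refine ⟨γ', α, δ', t, hδ0, ⟨δ', hαδ.symm⟩, hz, hx, ?_, fun τ => ⟨?_, hden τ⟩⟩
  · rw [atImInfty, tendsto_comap_iff]
    have : UpperHalfPlane.im ∘ t = fun τ : ℍ => (α / δ' : ℝ) * τ.im := funext fun τ => him τ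
    rw [this]
    exact tendsto_comap.const_mul_atTop (div_pos hαR hδR)
  · ext
    have hd := denomC_ne_zero γ τ
    rw [coe_scale, coe_SL_smul, coe_SL_smul, e00, e01, ht]
    have hd' := denomC_ne_zero γ' (t τ)
    rw [hden τ] at *
    have h1 : x * β - y * δ' = m * γ 0 1 := by
      rw [hδ, hβ]; linear_combination m * γ 0 1 * hxz
    have h1' : (x * β - y * δ' : ℂ) = m * γ 0 1 := by exact_mod_cast h1
    have h2 : (m * γ 0 0 : ℂ) = α * x := by exact_mod_cast hx
    field_simp
    push_cast
    linear_combination τ * h2 - h1'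

lemma norm_thetaQuart_smul (γ : SL(2, ℤ)) (c d : ZMod 2) (h : ¬(c = 0 ∧ d = 0)) (τ : ℍ) :
    ‖thetaQuart c d (γ • τ : ℍ)‖ = ‖denomC γ τ‖ ^ 2 *
      ‖thetaQuart (c * (γ 0 0 : ℤ) + d * (γ 1 0 : ℤ)) (c * (γ 0 1 : ℤ) + d * (γ 1 1 : ℤ)) τ‖ := by
  have h1 : ∀ a b c d, ‖permSign a b c d‖ = 1 := by
    intro a b c d; rw [permSign]; split_ifs <;> simp
  rw [thetaLaw γ c d h τ, norm_mul, norm_mul, h1, one_mul, norm_pow]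

lemma exists_tendsto_norm_thetaQuart_scale (m : ℕ) [NeZero m] (γ : SL(2, ℤ))
    (c d : ZMod 2) (h : ¬(c = 0 ∧ d = 0)) :
    ∃ l : ℝ, Tendsto (fun τ => ‖thetaQuart c d (scale m (γ • τ))‖ / ‖denomC γ τ‖ ^ 2)
      atImInfty (𝓝 l) := by
  obtain ⟨γ', α, δ, t, hδ, hα, h10, h00, ht, hτ⟩ := exists_scale_smul_eq_smul m γ
  have h2 : ∀ c d : ZMod 2, ∃ l, Tendsto (fun τ => ‖thetaQuart c d (t τ)‖) atImInfty (𝓝 l) := by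
    intro c d
    have : ∀ x : ZMod 2, x = 0 ∨ x = 1 := by decide
    rcases this c with rfl | rfl
    · exact ⟨_, ((tendsto_thetaQuart_zero d).comp ht).norm⟩
    · exact ⟨_, (tendsto_norm_thetaQuart_one d).comp ht⟩
  obtain ⟨l, hl⟩ := h2 (c * (γ' 0 0 : ℤ) + d * (γ' 1 0 : ℤ)) (c * (γ' 0 1 : ℤ) + d * (γ' 1 1 : ℤ))
  refine ⟨l / δ ^ 2, (hl.div_const _).congr fun τ => ?_⟩
  have h3 := norm_ne_zero_iff.mpr (denomC_ne_zero γ' (t τ))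
  have h4 : (δ : ℝ) ≠ 0 := by exact_mod_cast hδ.ne'
  rw [(hτ τ).1, (hτ τ).2, norm_thetaQuart_smul _ _ _ h, norm_mul, Complex.norm_natCast]
  field_simp

lemma tendsto_norm_thetaQuart_scale (k : ℕ) (γ : SL(2, ℤ)) (hγ : γ ∉ Gamma0 (2 * 2 ^ k)) :
    ∃ l : ℝ, 0 < l ∧
      Tendsto (fun τ => ‖thetaQuart 0 1 (scale (2 ^ k) (γ • τ))‖ / ‖denomC γ τ‖ ^ 2)
        atImInfty (𝓝 l) := by
  obtain ⟨γ', α, δ, t, hδ, hα, h10, h00, ht, hτ⟩ := exists_scale_smul_eq_smul (2 ^ k) γ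
  have hodd : ((γ' 1 0 : ℤ) : ZMod 2) = 1 := by
    have : ∀ x : ZMod 2, x ≠ 0 → x = 1 := by decide
    refine this _ fun hz => hγ ?_
    rw [Gamma0_mem, ZMod.intCast_zmod_eq_zero_iff_dvd]
    have hz2 : (2 : ℤ) ∣ γ' 1 0 := by exact_mod_cast (ZMod.intCast_zmod_eq_zero_iff_dvd _ 2).mp hz
    obtain ⟨z, hz⟩ := hz2
    have hcop : IsCoprime ((2 : ℤ) ^ k) (γ' 0 0) := by
      refine IsCoprime.pow_left ⟨-γ' 0 1 * z, γ' 1 1, ?_⟩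
      have := SL_det γ'
      rw [hz] at this
      linear_combination this
    have hα2 : (2 : ℤ) ^ k ∣ α := hcop.dvd_of_dvd_mul_right ⟨γ 0 0, by
      rw [← h00]; push_cast; rfl⟩
    rw [h10, hz]
    obtain ⟨w, hw⟩ := hα2
    exact ⟨w * z, by rw [hw]; push_cast; ring⟩
  have hlim := (tendsto_norm_thetaQuart_one (γ' 1 1 : ℤ)).comp ht
  have h4 : (0 : ℝ) < δ := by exact_mod_cast hδ
  refine ⟨1 / δ ^ 2, by positivity, (hlim.div_const _).congr fun τ => ?_⟩
  have h3 := norm_ne_zero_iff.mpr (denomC_ne_zero γ' (t τ))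
  rw [(hτ τ).1, (hτ τ).2, norm_thetaQuart_smul _ _ _ (by decide), norm_mul, Complex.norm_natCast,
    hodd]
  simp only [zero_mul, one_mul, zero_add, Function.comp]
  field_simp

lemma Theta_pow_four (τ : ℍ) : Theta τ ^ 4 = -thetaQuart 1 1 (scale 2 τ) := by
  rw [Theta_eq_jacobiTheta, jacobiTheta_eq_jacobiTheta₂]
  simp [thetaQuart]

lemma Theta_ne_zero (τ : ℍ) : Theta τ ≠ 0 := by
  intro h
  have h1 := Theta_pow_four τ
  rw [h] at h1
  exact thetaQuart_ne_zero 1 1 (scale 2 τ) (by simpa using h1.symm)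

lemma Theta_smul_pow_four {γ : SL(2, ℤ)} (hγ : γ ∈ Gamma0 4) (τ : ℍ) :
    Theta (γ • τ) ^ 4 = denomC γ τ ^ 2 * Theta τ ^ 4 := by
  rw [Theta_pow_four, Theta_pow_four,
    thetaQuart_scale_smul 2 even_two γ hγ 1 1 (by simp)]
  ring

lemma exists_tendsto_norm_Theta (γ : SL(2, ℤ)) :
    ∃ l, Tendsto (fun τ => ‖Theta (γ • τ)‖ ^ 4 / ‖denomC γ τ‖ ^ 2) atImInfty (𝓝 l) := by
  obtain ⟨l, hl⟩ := exists_tendsto_norm_thetaQuart_scale 2 γ 1 1 (by simp)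
  refine ⟨l, hl.congr fun τ => ?_⟩
  rw [← norm_pow (Theta _), Theta_pow_four, norm_neg]

/-- A form `D` of weight `s / 2` on `Γ₀(m)` with the automorphy factor of `θ ^ s`, without zeros on
`ℍ`, with expansion `q + O(q²)` at `∞` and not vanishing at the other cusps. -/
structure IsDenominator (m s : ℕ) (D D₀ : ℍ → ℂ) (δ : PowerSeries ℤ) : Prop where
  ne_zero : ∀ τ, D τ ≠ 0
  mdifferentiable : MDiff D
  eq_q_mul : ∀ τ : ℍ, D τ = Function.Periodic.qParam 1 τ * D₀ τ
  qSeries : QSeries D₀ (δ.map (Int.castRingHom ℂ))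
  coeff_zero : δ.coeff 0 = 1
  smul : ∀ γ ∈ Gamma0 m, ∀ τ, D (γ • τ) = (Theta (γ • τ) / Theta τ) ^ s * D τ
  tendsto : ∀ γ ∉ Gamma0 m, ∃ l, 0 < l ∧
    Tendsto (fun τ => ‖D (γ • τ)‖ ^ 4 / ‖denomC γ τ‖ ^ (2 * s)) atImInfty (𝓝 l)

lemma isDenominator_four :
    IsDenominator 4 4 (fun τ => Function.Periodic.qParam 1 τ * etaSum 1 τ ^ 4)
      (fun τ => etaSum 1 τ ^ 4) (etaSeries 1 ^ 4) := by
  have key (τ : ℍ) : Function.Periodic.qParam 1 τ * etaSum 1 τ ^ 4 =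
      thetaQuart 0 1 (scale 2 τ) / 16 := by
    have h := thetaTwo_eq_etaSum 1 τ
    have h1 : thetaQuart 0 1 (scale 2 τ) = thetaTwo (2 * (1 : ℕ) * τ) ^ 4 := by
      simp [thetaQuart]
    have h2 : cexp (2 * π * Complex.I * (1 : ℕ) * τ / 4) ^ 4 = Function.Periodic.qParam 1 τ := by
      rw [Function.Periodic.qParam, ← Complex.exp_nat_mul]
      congr 1; push_cast; ring
    rw [h1, h, mul_pow, mul_pow, h2]
    ring
  have hq : QSeries (fun τ => etaSum 1 τ ^ 4) ((etaSeries 1 ^ 4).map (Int.castRingHom ℂ)) := by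
    rw [map_pow]; exact (QSeries.eta 1).pow 4
  refine ⟨fun τ => ?_, (QSeries.q.mul hq).mdifferentiable, fun τ => rfl, hq, ?_,
    fun γ hγ τ => ?_, fun γ hγ => ?_⟩
  · rw [key]
    exact div_ne_zero (thetaQuart_ne_zero _ _ _) (by norm_num)
  · have := coeff_zero_etaSeries 1
    rw [PowerSeries.coeff_zero_eq_constantCoeff] at *
    simp [this]
  · rw [div_pow, Theta_smul_pow_four hγ, mul_div_cancel_right₀ _ (pow_ne_zero _ (Theta_ne_zero τ))]
    rw [key, key, thetaQuart_scale_smul 2 even_two γ hγ 0 1 (by simp)]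
    ring
  · obtain ⟨l, hl, h⟩ := tendsto_norm_thetaQuart_scale 1 γ hγ
    refine ⟨(l / 16) ^ 4, by positivity, ((h.div_const 16).pow 4).congr fun τ => ?_⟩
    rw [key, norm_div, show ‖(16 : ℂ)‖ = 16 by simp]
    change (‖thetaQuart 0 1 (scale 2 (γ • τ))‖ / _ / 16) ^ 4 = _
    ring

lemma eq_of_pow_four_eq {u v : ℂ} (h : v ^ 4 = u ^ 4) (h' : (1 - 2 * v) ^ 4 = (1 - 2 * u) ^ 4)
    (hu : ‖u‖ < 1 / 10) : v = u := by
  have hn : ‖v‖ = ‖u‖ := by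
    have := congrArg norm h
    rw [norm_pow, norm_pow] at this
    exact (pow_left_inj₀ (norm_nonneg _) (norm_nonneg _) (by norm_num)).mp this
  have h2 : (v - u) * ((1 - v - u) * ((1 - 2 * v) ^ 2 + (1 - 2 * u) ^ 2)) = 0 := by
    linear_combination (-1 / 4 : ℂ) * h'
  refine sub_eq_zero.mp ((mul_eq_zero.mp h2).resolve_right (mul_ne_zero ?_ ?_))
  · intro h3
    have : ‖(1 : ℂ)‖ ≤ ‖v‖ + ‖u‖ := by
      rw [show (1 : ℂ) = v + u by linear_combination h3]
      exact norm_add_le _ _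
    rw [norm_one] at this
    linarith
  · intro h3
    have h4 : (2 : ℂ) = 4 * v + 4 * u - 4 * v ^ 2 - 4 * u ^ 2 := by linear_combination h3
    have h5 : ‖(2 : ℂ)‖ ≤ 4 * ‖v‖ + 4 * ‖u‖ + 4 * ‖v‖ ^ 2 + 4 * ‖u‖ ^ 2 := by
      rw [h4]
      refine (norm_sub_le _ _).trans (add_le_add ((norm_sub_le _ _).trans
        (add_le_add ((norm_add_le _ _).trans ?_) ?_)) ?_) <;> simp
    rw [Complex.norm_ofNat, hn] at h5
    nlinarith [norm_nonneg u]

lemma mdifferentiable_SL_smul (γ : SL(2, ℤ)) : MDiff (fun τ : ℍ => γ • τ) :=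
  UpperHalfPlane.mdifferentiable_smul (g := (γ : GL (Fin 2) ℝ)) (by simp)

lemma eq_zero_of_eventually_atImInfty {g : ℍ → ℂ} (hg : MDiff g) (h : ∀ᶠ τ in atImInfty, g τ = 0)
    (τ : ℍ) : g τ = 0 := by
  rw [atImInfty, Filter.eventually_comap] at h
  obtain ⟨y, hy⟩ := (h.and (Filter.eventually_gt_atTop 0)).exists_forall_of_atTop
  set y' := max y 0 + 1
  have hy'0 : 0 < y' := by positivity
  let σ : ℍ := ⟨y' * Complex.I, by simpa using hy'0⟩
  have hσ : σ.im = y' := by simp [σ, UpperHalfPlane.im]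
  have hev : ∀ᶠ z in 𝓝 σ, g z = 0 := by
    have : ∀ᶠ z : ℍ in 𝓝 σ, y < z.im :=
      UpperHalfPlane.continuous_im.continuousAt.eventually_const_lt
        (by rw [hσ]; exact (le_max_left _ _).trans_lt (lt_add_one _))
    filter_upwards [this] with z hz using (hy _ hz.le).1 z rfl
  exact congrFun (UpperHalfPlane.eq_zero_of_frequently hg
    (hev.filter_mono nhdsWithin_le_nhds).frequently) τ

lemma isDenominator_sixteen :
    IsDenominator 16 1 (fun τ => Function.Periodic.qParam 1 τ * etaSum 4 τ)
      (fun τ => etaSum 4 τ) (etaSeries 4) := by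
  set D : ℍ → ℂ := fun τ => Function.Periodic.qParam 1 τ * etaSum 4 τ with hD
  have key (τ : ℍ) : D τ ^ 4 = thetaQuart 0 1 (scale 8 τ) / 16 := by
    have h := thetaTwo_eq_etaSum 4 τ
    have h1 : thetaQuart 0 1 (scale 8 τ) = thetaTwo (2 * (4 : ℕ) * τ) ^ 4 := by
      simp only [thetaQuart, coe_scale, if_true]
      norm_num
    have h2 : cexp (2 * π * Complex.I * (4 : ℕ) * τ / 4) = Function.Periodic.qParam 1 τ := by
      rw [Function.Periodic.qParam]
      congr 1; push_cast; ring
    rw [h1, h, h2, hD]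
    ring
  have hq := QSeries.eta 4
  have hDm : QSeries D _ := QSeries.q.mul hq
  have hD4 (γ : SL(2, ℤ)) (hγ : γ ∈ Gamma0 16) (τ : ℍ) :
      D (γ • τ) ^ 4 = denomC γ τ ^ 2 * D τ ^ 4 := by
    rw [key, key, thetaQuart_scale_smul 8 (by decide) γ hγ 0 1 (by simp)]
    ring
  have hT4 (γ : SL(2, ℤ)) (hγ : γ ∈ Gamma0 16) (τ : ℍ) :
      (Theta (γ • τ) - 2 * D (γ • τ)) ^ 4 = denomC γ τ ^ 2 * (Theta τ - 2 * D τ) ^ 4 := by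
    have h8 (τ : ℍ) : scale 2 (scale 4 τ) = scale 8 τ := by
      ext; simp only [coe_scale]; push_cast; ring
    rw [← Theta_scale_four, ← Theta_scale_four, Theta_pow_four, Theta_pow_four, h8, h8,
      thetaQuart_scale_smul 8 (by decide) γ hγ 1 1 (by simp)]
    ring
  have hsmall : ∀ᶠ τ in atImInfty, ‖D τ / Theta τ‖ < 1 / 10 := by
    have h1 := hDm.tendsto.div QSeries.theta.tendsto (by
      rw [PowerSeries.coeff_map, coeff_zero_thetaSeries]; simp)
    have h2 := h1.norm
    simp only [PowerSeries.coeff_zero_eq_constantCoeff, map_mul, PowerSeries.constantCoeff_X,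
      zero_mul, zero_div, norm_zero] at h2
    exact h2.eventually_lt_const (by norm_num)
  refine ⟨fun τ h => ?_, hDm.mdifferentiable, fun τ => rfl, hq, coeff_zero_etaSeries 4,
    fun γ hγ τ => ?_, fun γ hγ => ?_⟩
  · have := key τ
    rw [h] at this
    exact thetaQuart_ne_zero 0 1 (scale 8 τ) (by simpa using this.symm)
  · have hT (τ) := Theta_ne_zero τ
    have h4 : ∀ τ, Theta (γ • τ) ^ 4 = denomC γ τ ^ 2 * Theta τ ^ 4 :=
      Theta_smul_pow_four (Gamma0_le (by norm_num) hγ)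
    have hmain := eq_zero_of_eventually_atImInfty
      (g := fun τ => D (γ • τ) * Theta τ - Theta (γ • τ) * D τ)
      (((hDm.mdifferentiable.comp (mdifferentiable_SL_smul γ)).mul
        QSeries.theta.mdifferentiable).sub
        ((QSeries.theta.mdifferentiable.comp (mdifferentiable_SL_smul γ)).mul
          hDm.mdifferentiable)) ?_ τ
    · rw [pow_one, div_mul_eq_mul_div, eq_div_iff (hT τ)]
      linear_combination hmain
    · filter_upwards [hsmall] with τ hτ
      have hj := denomC_ne_zero γ τ
      have h := eq_of_pow_four_eq (u := D τ / Theta τ) (v := D (γ • τ) / Theta (γ • τ)) (by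
          rw [div_pow, div_pow, h4, hD4 γ hγ, mul_div_mul_left _ _ (pow_ne_zero _ hj)]) (by
          have h1 (σ : ℍ) : 1 - 2 * (D σ / Theta σ) = (Theta σ - 2 * D σ) / Theta σ := by
            field_simp [hT σ]
          rw [h1, h1, div_pow, div_pow, h4, hT4 γ hγ, mul_div_mul_left _ _ (pow_ne_zero _ hj)]) hτ
      rw [div_eq_div_iff (hT _) (hT _)] at h
      linear_combination h
  · obtain ⟨l, hl, h⟩ := tendsto_norm_thetaQuart_scale 3 γ hγ
    refine ⟨l / 16, by positivity, (h.div_const 16).congr fun τ => ?_⟩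
    rw [← norm_pow (D _), key, norm_div, show ‖(16 : ℂ)‖ = 16 by simp]
    change ‖thetaQuart 0 1 (scale 8 (γ • τ))‖ / _ / 16 = _
    ring

lemma integral_exp_two_pi_int (k : ℤ) :
    ∫ x in (0 : ℝ)..1, cexp (2 * π * Complex.I * k * x) = if k = 0 then 1 else 0 := by
  split_ifs with hk
  · simp [hk]
  · have hc : (2 * π * Complex.I * k : ℂ) ≠ 0 := by
      simp [Real.pi_ne_zero, hk]
    rw [integral_exp_mul_complex hc]
    have : cexp (2 * π * Complex.I * k) = 1 := by
      rw [Complex.exp_eq_one_iff]; exact ⟨k, by ring⟩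
    simp [this]

lemma FourierAtInfty.integral_eq {f : ℍ → ℂ} {a : ℤ → ℂ} (ha : FourierAtInfty f a) (m : ℤ)
    {y : ℝ} (hy : 0 < y) :
    ∫ x in (0 : ℝ)..1, cexp (2 * π * Complex.I * (-m : ℤ) * x) *
      f (UpperHalfPlane.ofComplex (x + y * Complex.I)) = a m * Real.exp (-2 * π * m * y) := by
  have hpt (x : ℝ) : (UpperHalfPlane.ofComplex (x + y * Complex.I) : ℂ) = x + y * Complex.I := by
    rw [UpperHalfPlane.ofComplex_apply_of_im_pos (by simpa using hy)]
  have hterm (n : ℤ) (x : ℝ) : cexp (2 * π * Complex.I * (-m : ℤ) * x) *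
      (a n * cexp (2 * π * Complex.I * n * (x + y * Complex.I))) =
      a n * Real.exp (-2 * π * n * y) * cexp (2 * π * Complex.I * (n - m : ℤ) * x) := by
    rw [Complex.ofReal_exp, mul_left_comm, mul_assoc (a n), ← Complex.exp_add, ← Complex.exp_add]
    congr 2
    push_cast
    linear_combination (2 * π * n * y : ℂ) * Complex.I_sq
  have hnorm (n : ℤ) (x : ℝ) : ‖a n * Real.exp (-2 * π * n * y) *
      cexp (2 * π * Complex.I * (n - m : ℤ) * x)‖ = ‖a n‖ * Real.exp (-2 * π * n * y) := by
    have : (2 * π * Complex.I * (n - m : ℤ) * x : ℂ) =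
        ((2 * π * (n - m : ℤ) * x : ℝ) : ℂ) * Complex.I := by push_cast; ring
    rw [norm_mul, norm_mul, this, Complex.norm_exp_ofReal_mul_I, mul_one, Complex.norm_real,
      Real.norm_of_nonneg (Real.exp_pos _).le]
  have hsum : Summable fun n : ℤ => ‖a n‖ * Real.exp (-2 * π * n * y) := by
    have h0 := (ha (UpperHalfPlane.ofComplex (((0 : ℝ) : ℂ) + y * Complex.I))).summable.norm
    simp only [hpt] at h0
    refine h0.congr fun n => ?_
    rw [norm_mul, Complex.norm_exp]
    congr 2
    simp
  have hseries := intervalIntegral.hasSum_intervalIntegral_of_summable_norm (a := 0) (b := 1)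
    (f := fun (n : ℤ) => (⟨fun x : ℝ => a n * Real.exp (-2 * π * n * y) *
      cexp (2 * π * Complex.I * (n - m : ℤ) * x), by fun_prop⟩ : C(ℝ, ℂ))) (by
      refine hsum.of_nonneg_of_le (fun n => norm_nonneg _) fun n => ?_
      rw [ContinuousMap.norm_le _ (by positivity)]
      exact fun x => (hnorm n x).le)
  have h2 : ∀ x : ℝ, ∑' n : ℤ, a n * Real.exp (-2 * π * n * y) *
      cexp (2 * π * Complex.I * (n - m : ℤ) * x) = cexp (2 * π * Complex.I * (-m : ℤ) * x) *
      f (UpperHalfPlane.ofComplex (x + y * Complex.I)) := fun x => by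
    have h := (ha (UpperHalfPlane.ofComplex (x + y * Complex.I))).mul_left
      (cexp (2 * π * Complex.I * (-m : ℤ) * x))
    simp only [hpt, hterm] at h
    exact h.tsum_eq
  simp only [ContinuousMap.coe_mk, h2, intervalIntegral.integral_const_mul,
    integral_exp_two_pi_int, sub_eq_zero] at hseries
  have h3 := hasSum_single m (f := fun i : ℤ =>
    a i * (Real.exp (-2 * π * i * y) : ℂ) * if i = m then 1 else 0) fun i hi => by simp [hi]
  rw [if_pos rfl, mul_one] at h3
  exact hseries.unique h3

lemma FourierAtInfty.eq_zero_of_nonpos {f : ℍ → ℂ} {a : ℤ → ℂ} (ha : FourierAtInfty f a)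
    (hf : Tendsto f atImInfty (𝓝 0)) {m : ℤ} (hm : m ≤ 0) : a m = 0 := by
  rw [← norm_le_zero_iff]
  refine le_of_forall_pos_le_add fun ε hε => ?_
  rw [zero_add]
  have h1 : ∀ᶠ τ in atImInfty, ‖f τ‖ < ε := by
    have := hf.norm
    rw [norm_zero] at this
    exact this.eventually_lt_const hε
  rw [atImInfty, Filter.eventually_comap] at h1
  obtain ⟨y, hy, hy0⟩ := (h1.and (Filter.eventually_gt_atTop 0)).exists
  have h2 : ‖a m * Real.exp (-2 * π * m * y)‖ ≤ ε := by
    rw [← ha.integral_eq m hy0]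
    refine (intervalIntegral.norm_integral_le_of_norm_le_const (C := ε) fun x _ => ?_).trans
      (by simp)
    have : (2 * π * Complex.I * (-m : ℤ) * x : ℂ) =
        ((2 * π * (-m : ℤ) * x : ℝ) : ℂ) * Complex.I := by push_cast; ring
    rw [norm_mul, this, Complex.norm_exp_ofReal_mul_I, one_mul]
    refine (hy _ ?_).le
    have h3 : 0 < (x + y * Complex.I : ℂ).im := by simpa using hy0
    rw [UpperHalfPlane.ofComplex_apply_of_im_pos h3]
    simp [UpperHalfPlane.im]
  refine le_trans ?_ h2
  rw [norm_mul, Complex.norm_real, Real.norm_of_nonneg (Real.exp_pos _).le]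
  refine le_mul_of_one_le_right (norm_nonneg _) (Real.one_le_exp ?_)
  have : (m : ℝ) ≤ 0 := by exact_mod_cast hm
  have := mul_nonneg (mul_nonneg (neg_nonneg.mpr this) hy0.le) Real.pi_pos.le
  linarith

lemma FourierAtInfty.qSeries {f : ℍ → ℂ} {a : ℤ → ℂ} (ha : FourierAtInfty f a)
    (h0 : ∀ m < 0, a m = 0) : QSeries f (PowerSeries.mk fun n => a n) := by
  intro τ
  have h := ha τ
  rw [← (Nat.cast_injective (R := ℤ)).hasSum_iff] at h
  · refine h.of_eq fun n => ?_
    simp [qParam_one_pow]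
  · intro n hn
    rw [h0 n, zero_mul]
    by_contra! h
    exact hn ⟨n.toNat, by simp [h]⟩

lemma QSeries.vadd {g : ℍ → ℂ} {φ : PowerSeries ℂ} (h : QSeries g φ) (τ : ℍ) :
    g ((1 : ℝ) +ᵥ τ) = g τ := by
  refine (h _).unique ?_
  refine (h τ).of_eq fun n => ?_
  have : cexp (2 * π * Complex.I * n * (1 : ℝ)) = 1 := by
    rw [Complex.exp_eq_one_iff]; exact ⟨n, by push_cast; ring⟩
  rw [qParam_one_pow, qParam_one_pow, UpperHalfPlane.coe_vadd, mul_add, Complex.exp_add, this,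
    one_mul]

lemma periodic_comp_ofComplex {g : ℍ → ℂ} (h : ∀ τ, g ((1 : ℝ) +ᵥ τ) = g τ) :
    Function.Periodic (g ∘ UpperHalfPlane.ofComplex) (1 : ℝ) := by
  intro z
  simp only [Function.comp_apply]
  by_cases hz : 0 < z.im
  · have hz1 : 0 < (z + (1 : ℝ)).im := by simpa using hz
    rw [UpperHalfPlane.ofComplex_apply_of_im_pos hz1, UpperHalfPlane.ofComplex_apply_of_im_pos hz,
      ← h ⟨z, hz⟩]
    congr 1
    ext
    simp [add_comm]
  · have hz1 : ¬ 0 < (z + (1 : ℝ)).im := by simpa using hz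
    rw [UpperHalfPlane.ofComplex_apply_of_im_nonpos (not_lt.mp hz1),
      UpperHalfPlane.ofComplex_apply_of_im_nonpos (not_lt.mp hz)]

lemma mdifferentiable_div {G D : ℍ → ℂ} (hG : MDiff G) (hD : MDiff D) (h0 : ∀ τ, D τ ≠ 0) :
    MDiff (fun τ => G τ / D τ) := by
  rw [UpperHalfPlane.mdifferentiable_iff] at *
  exact hG.div hD fun z _ => h0 _

/-- Vanishing of the `M`-th coefficient of `G / D₀ ^ M`, by the residue theorem for the weight two
form `G / D ^ M`. -/
lemma IsDenominator.exists_coeff_eq_zero {m s : ℕ} [NeZero m] {D D₀ : ℍ → ℂ} {δ : PowerSeries ℤ}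
    (hD : IsDenominator m s D D₀ δ) {G : ℍ → ℂ} {φ : PowerSeries ℂ} (hG : QSeries G φ) (M : ℕ)
    (hΓ : ∀ γ ∈ Gamma0 m, ∀ τ : ℍ, G (γ • τ) / D (γ • τ) ^ M = denomC γ τ ^ 2 * (G τ / D τ ^ M))
    (hc : ∀ γ : SL(2, ℤ), γ ∉ Gamma0 m → Tendsto
      (fun τ : ℍ => ‖G (γ • τ) / D (γ • τ) ^ M‖ / ‖denomC γ τ‖ ^ 2) atImInfty (𝓝 0)) :
    ∃ ψ : PowerSeries ℂ, ψ.coeff M = 0 ∧ ψ * (δ.map (Int.castRingHom ℂ)) ^ M = φ := by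
  have hD0 (τ) : D₀ τ ≠ 0 := fun h => hD.ne_zero τ (by rw [hD.eq_q_mul, h, mul_zero])
  have hDM := hD.qSeries.pow M
  set H : ℍ → ℂ := fun τ => G τ / D₀ τ ^ M with hH
  have hHm : MDiff H := mdifferentiable_div hG.mdifferentiable hDM.mdifferentiable
    fun τ => pow_ne_zero _ (hD0 τ)
  have hper := periodic_comp_ofComplex (g := H) fun τ => by
    simp only [hH, hG.vadd, hD.qSeries.vadd]
  have hbdd : UpperHalfPlane.IsBoundedAtImInfty H := by
    have h1 : Tendsto H atImInfty _ := hG.tendsto.div hDM.tendsto (by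
      have := hD.coeff_zero
      rw [PowerSeries.coeff_zero_eq_constantCoeff] at *
      rw [map_pow, ← PowerSeries.coeff_zero_eq_constantCoeff_apply, PowerSeries.coeff_map,
        PowerSeries.coeff_zero_eq_constantCoeff, this]
      simp)
    exact h1.isBigO_one ℝ
  have hres := tendsto_integral_of_weight_two (mdifferentiable_div hG.mdifferentiable
    (hD.mdifferentiable.pow M) fun τ => pow_ne_zero _ (hD.ne_zero τ)) hΓ hc
  refine ⟨UpperHalfPlane.qExpansion 1 H, ?_, ?_⟩
  · refine tendsto_nhds_unique (tendsto_const_nhds.congr' ?_) hres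
    filter_upwards [Filter.eventually_gt_atTop 0] with y hy
    rw [UpperHalfPlane.qExpansion_coeff_eq_intervalIntegral one_pos hper hHm hbdd M hy]
    rw [Complex.ofReal_one, div_one, one_mul]
    refine intervalIntegral.integral_congr fun x _ => ?_
    have hz : 0 < (x + y * Complex.I : ℂ).im := by simpa using hy
    rw [UpperHalfPlane.ofComplex_apply_of_im_pos hz]
    change _ = _ / D _ ^ M
    rw [hD.eq_q_mul ⟨_, hz⟩, mul_pow]
    change 1 / _ * (G _ / _) = _
    rw [div_mul_div_comm, one_mul]
    rfl
  · have hq : QSeries H (UpperHalfPlane.qExpansion 1 H) := fun τ =>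
      (UpperHalfPlane.hasSum_qExpansion one_pos hper hHm hbdd τ).of_eq fun n => rfl
    refine QSeries.unique ((hq.mul hDM).congr fun τ => ?_) hG
    simp only [hH]
    exact (div_mul_cancel₀ _ (pow_ne_zero _ (hD0 τ))).symm

section PIntegers

variable {L : Subfield ℂ} {P : Ideal (𝓞 L)}

lemma coe_coe_ringOfIntegers_add (x y : 𝓞 L) :
    (((x + y : 𝓞 L) : L) : ℂ) = ((x : L) : ℂ) + ((y : L) : ℂ) := rfl

lemma coe_coe_ringOfIntegers_mul (x y : 𝓞 L) :
    (((x * y : 𝓞 L) : L) : ℂ) = ((x : L) : ℂ) * ((y : L) : ℂ) := rfl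

lemma coe_coe_ringOfIntegers_neg (x : 𝓞 L) :
    (((-x : 𝓞 L) : L) : ℂ) = -((x : L) : ℂ) := rfl

lemma coe_coe_ringOfIntegers_one : (((1 : 𝓞 L) : L) : ℂ) = 1 := rfl

lemma congMod_one_zero_iff {x : ℂ} :
    CongMod L P 1 x 0 ↔ ∃ a b : 𝓞 L, a ∈ P ∧ b ∉ P ∧ x * ((b : L) : ℂ) = ((a : L) : ℂ) := by
  simp [CongMod]

variable (L P) in
/-- The ring of `P`-integral complex numbers in `L`. -/
def pIntegers [hP : P.IsPrime] : Subring ℂ where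
  carrier := {x | PIntegral L P x}
  mul_mem' := by
    rintro x y ⟨a, b, hb, h⟩ ⟨a', b', hb', h'⟩
    refine ⟨a * a', b * b', fun H => (hP.mem_or_mem H).elim hb hb', ?_⟩
    rw [coe_coe_ringOfIntegers_mul, coe_coe_ringOfIntegers_mul, ← h, ← h']; ring
  one_mem' := ⟨1, 1, (Ideal.ne_top_iff_one P).mp hP.ne_top, one_mul _⟩
  add_mem' := by
    rintro x y ⟨a, b, hb, h⟩ ⟨a', b', hb', h'⟩
    refine ⟨a * b' + a' * b, b * b', fun H => (hP.mem_or_mem H).elim hb hb', ?_⟩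
    rw [coe_coe_ringOfIntegers_add, coe_coe_ringOfIntegers_mul, coe_coe_ringOfIntegers_mul,
      coe_coe_ringOfIntegers_mul, ← h, ← h']; ring
  zero_mem' := ⟨0, 1, (Ideal.ne_top_iff_one P).mp hP.ne_top, zero_mul _⟩
  neg_mem' := by
    rintro x ⟨a, b, hb, h⟩
    refine ⟨-a, b, hb, ?_⟩
    rw [coe_coe_ringOfIntegers_neg, ← h]; ring

variable (L P) in
/-- The ideal of the ring of `P`-integral numbers generated by `P`. -/
def pIdeal [hP : P.IsPrime] : Ideal (pIntegers L P) where
  carrier := {x | CongMod L P 1 (x : ℂ) 0}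
  add_mem' := by
    rintro ⟨x, hx⟩ ⟨y, hy⟩ h h'
    obtain ⟨a, b, ha, hb, h⟩ := congMod_one_zero_iff.mp h
    obtain ⟨a', b', ha', hb', h'⟩ := congMod_one_zero_iff.mp h'
    refine congMod_one_zero_iff.mpr ⟨a * b' + a' * b, b * b',
      P.add_mem (P.mul_mem_right _ ha) (P.mul_mem_right _ ha'),
      fun H => (hP.mem_or_mem H).elim hb hb', ?_⟩
    rw [coe_coe_ringOfIntegers_add, coe_coe_ringOfIntegers_mul, coe_coe_ringOfIntegers_mul,
      coe_coe_ringOfIntegers_mul, ← h, ← h']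
    push_cast; ring
  zero_mem' := congMod_one_zero_iff.mpr
    ⟨0, 1, P.zero_mem, (Ideal.ne_top_iff_one P).mp hP.ne_top, zero_mul _⟩
  smul_mem' := by
    rintro ⟨x, hx⟩ ⟨y, hy⟩ h'
    obtain ⟨a, b, hb, h⟩ := id hx
    obtain ⟨a', b', ha', hb', h'⟩ := congMod_one_zero_iff.mp h'
    refine congMod_one_zero_iff.mpr ⟨a * a', b * b', P.mul_mem_left _ ha',
      fun H => (hP.mem_or_mem H).elim hb hb', ?_⟩
    rw [coe_coe_ringOfIntegers_mul, coe_coe_ringOfIntegers_mul, ← h, ← h', smul_eq_mul]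
    push_cast; ring

variable [hP : P.IsPrime]

lemma mem_pIdeal {x : pIntegers L P} : x ∈ pIdeal L P ↔ CongMod L P 1 (x : ℂ) 0 := Iff.rfl

lemma pIdeal_ne_top : pIdeal L P ≠ ⊤ := by
  rw [Ideal.ne_top_iff_one, mem_pIdeal, congMod_one_zero_iff]
  rintro ⟨a, b, ha, hb, h⟩
  refine hb ?_
  have : b = a := by
    apply NumberField.RingOfIntegers.coe_injective
    apply Subtype.coe_injective
    simpa using h
  rwa [this]

lemma charP_quotient_pIdeal {p : ℕ} (hp : p.Prime) (hpP : (p : 𝓞 L) ∈ P) :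
    CharP (pIntegers L P ⧸ pIdeal L P) p := by
  have : Nontrivial (pIntegers L P ⧸ pIdeal L P) := Ideal.Quotient.nontrivial_iff.mpr pIdeal_ne_top
  refine ringChar.of_eq (CharP.ringChar_of_prime_eq_zero hp ?_)
  rw [← map_natCast (Ideal.Quotient.mk (pIdeal L P)), Ideal.Quotient.eq_zero_iff_mem, mem_pIdeal,
    congMod_one_zero_iff]
  exact ⟨p, 1, hpP, (Ideal.ne_top_iff_one P).mp hP.ne_top, by
    rw [coe_coe_ringOfIntegers_one, mul_one]; norm_cast⟩

end PIntegers

lemma coeff_mul_expand {k : Type*} [CommRing k] (c : ℕ → k) {M : ℕ} (hM : M ≠ 0)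
    (U : PowerSeries k) (n : ℕ) :
    (PowerSeries.mk c * PowerSeries.expand M hM U).coeff (M * n) =
      (PowerSeries.mk (fun i => c (M * i)) * U).coeff n := by
  rw [PowerSeries.coeff_mul, PowerSeries.coeff_mul]
  symm
  refine Finset.sum_of_injOn (fun ij => (M * ij.1, M * ij.2)) ?_ ?_ ?_ ?_
  · intro x _ y _ h
    have := Nat.pos_of_ne_zero hM
    simpa [Prod.ext_iff, hM] using h
  · intro x hx
    simp only [Finset.mem_coe, Finset.HasAntidiagonal.mem_antidiagonal] at hx ⊢
    rw [← hx, mul_add]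
  · intro x hx hx'
    rw [Finset.HasAntidiagonal.mem_antidiagonal] at hx
    rw [PowerSeries.coeff_expand]
    split_ifs with h
    · exfalso
      obtain ⟨j, hj⟩ := h
      obtain ⟨i, hi⟩ : M ∣ x.1 := (Nat.dvd_add_left ⟨j, hj⟩).mp ⟨n, hx⟩
      refine hx' ⟨(i, j), ?_, by ext <;> simp [hi, hj]⟩
      simp only [Finset.mem_coe, Finset.HasAntidiagonal.mem_antidiagonal]
      rw [hi, hj, ← mul_add] at hx
      exact Nat.eq_of_mul_eq_mul_left (Nat.pos_of_ne_zero hM) hx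
    · rw [mul_zero]
  · intro x _
    simp [PowerSeries.coeff_expand_mul]

lemma coeff_eq_zero_of_mul {k : Type*} [CommRing k] {c : ℕ → k} (h0 : c 0 = 0)
    (h : ∀ n, 0 < n → ∃ U : PowerSeries k, U.coeff 0 = 1 ∧ (PowerSeries.mk c * U).coeff n = 0)
    (n : ℕ) : c n = 0 := by
  induction n using Nat.strong_induction_on with
  | _ n ih =>
    rcases Nat.eq_zero_or_pos n with rfl | hn
    · exact h0
    obtain ⟨U, hU, hn⟩ := h n hn
    rw [PowerSeries.coeff_mul, Finset.sum_eq_single (n, 0)] at hn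
    · simpa [hU] using hn
    · rintro ⟨i, j⟩ hij hne
      rw [Finset.HasAntidiagonal.mem_antidiagonal] at hij
      simp only at hij
      have : i < n := by
        refine lt_of_le_of_ne (by omega) fun hi => hne ?_
        ext
        · exact hi
        · simp only; omega
      simp [ih i this]
    · simp

lemma pow_prime_pow_eq_expand {k : Type*} [CommRing k] (p : ℕ) [Fact p.Prime] [CharP k p]
    (g : PowerSeries k) (b : ℕ) (hpb : p ^ b ≠ 0) : ∃ β : PowerSeries k,
      β.coeff 0 = g.coeff 0 ^ p ^ b ∧ g ^ p ^ b = PowerSeries.expand (p ^ b) hpb β := by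
  refine ⟨g.map (iterateFrobenius k p b), ?_, ?_⟩
  · rw [PowerSeries.coeff_map, iterateFrobenius_def]
  · rw [← PowerSeries.map_expand]
    exact (MvPowerSeries.map_iterateFrobenius_expand p (Fact.out : p.Prime).ne_zero g b).symm

/-- Congruences for the coefficients of `φ` from the vanishing of single coefficients of
`φ · α / δ ^ M`, where `α` is modulo `P` a power series in `q ^ (p ^ b)`. -/
lemma congMod_of_coeff_eq_zero {L : Subfield ℂ} {P : Ideal (𝓞 L)} [P.IsPrime] {p : ℕ}
    (hp : p.Prime) (hpP : (p : 𝓞 L) ∈ P) (b : ℕ) (hpb : p ^ b ≠ 0) {a : ℕ → ℂ}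
    (ha : ∀ n, PIntegral L P (a n))
    (ha0 : a 0 = 0) {δ : PowerSeries ℤ} (hδ : δ.coeff 0 = 1)
    (h : ∀ n, 0 < n → ∃ (ψ : PowerSeries ℂ) (α : PowerSeries (pIntegers L P))
      (β : PowerSeries (pIntegers L P ⧸ pIdeal L P)), ψ.coeff (p ^ b * n) = 0 ∧
      ψ * (δ.map (Int.castRingHom ℂ)) ^ (p ^ b * n) =
        PowerSeries.mk a * α.map (pIntegers L P).subtype ∧
      α.map (Ideal.Quotient.mk (pIdeal L P)) = PowerSeries.expand (p ^ b) hpb β ∧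
      β.coeff 0 = 1)
    (n : ℕ) : CongMod L P 1 (a (p ^ b * n)) 0 := by
  have : Fact p.Prime := ⟨hp⟩
  have := charP_quotient_pIdeal hp hpP
  set R := pIntegers L P
  set k := R ⧸ pIdeal L P
  set red : R →+* k := Ideal.Quotient.mk (pIdeal L P)
  let c : ℕ → R := fun n => ⟨a n, ha n⟩
  suffices H : ∀ n, red (c (p ^ b * n)) = 0 from
    mem_pIdeal.mp (Ideal.Quotient.eq_zero_iff_mem.mp (H n))
  obtain ⟨ε, hε⟩ : ∃ ε, δ * ε = 1 :=
    ⟨PowerSeries.invOfUnit δ 1, PowerSeries.mul_invOfUnit δ 1 (by simpa using hδ)⟩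
  have hε0 : ε.coeff 0 = 1 := by
    have := congrArg PowerSeries.constantCoeff hε
    rw [map_mul, ← PowerSeries.coeff_zero_eq_constantCoeff_apply, hδ, one_mul, map_one] at this
    rwa [PowerSeries.coeff_zero_eq_constantCoeff_apply]
  refine coeff_eq_zero_of_mul ?_ fun n hn => ?_
  · rw [mul_zero, show c 0 = 0 from Subtype.ext ha0, map_zero]
  obtain ⟨ψ, α, β, hψ, hmul, hα, hβ⟩ := h n hn
  obtain ⟨β', hβ', hεβ⟩ := pow_prime_pow_eq_expand p (ε.map (Int.castRingHom k)) b hpb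
  rw [PowerSeries.coeff_map, hε0, map_one, one_pow] at hβ'
  refine ⟨β * β' ^ n, ?_, ?_⟩
  · rw [PowerSeries.coeff_zero_eq_constantCoeff_apply] at hβ hβ' ⊢
    rw [map_mul, map_pow]
    exact (congrArg₂ (fun x y => x * y ^ n) hβ hβ').trans (by simp)
  have hexp : PowerSeries.expand (p ^ b) hpb (β * β' ^ n) = α.map red *
      (ε.map (Int.castRingHom k)) ^ (p ^ b * n) := by
    rw [map_mul, map_pow, ← hα, ← hεβ, ← pow_mul]
  rw [← coeff_mul_expand (fun i => red (c i)) hpb, hexp]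
  have e1 : PowerSeries.mk (fun i => red (c i)) = (PowerSeries.mk c).map red := by
    ext i; simp
  have e2 : ε.map (Int.castRingHom k) = (ε.map (Int.castRingHom R)).map red := by
    ext i; simp
  rw [e1, e2, ← map_pow, ← map_mul, ← map_mul, PowerSeries.coeff_map]
  suffices h0 : (PowerSeries.mk c * (α * (ε.map (Int.castRingHom R)) ^ (p ^ b * n))).coeff
      (p ^ b * n) = 0 by rw [h0, map_zero]
  apply Subtype.coe_injective
  change R.subtype _ = 0
  have e0 : (PowerSeries.mk c * (α * (ε.map (Int.castRingHom R)) ^ (p ^ b * n))).map R.subtype =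
      (PowerSeries.mk c).map R.subtype * (α.map R.subtype *
        (ε.map (Int.castRingHom R)).map R.subtype ^ (p ^ b * n)) := by
    rw [map_mul, map_mul, map_pow]
  have e3 : (PowerSeries.mk c).map R.subtype = PowerSeries.mk a := by
    ext i; simp [c]
  have e4 : (ε.map (Int.castRingHom R)).map R.subtype = ε.map (Int.castRingHom ℂ) := by
    ext i; simp
  rw [← PowerSeries.coeff_map, e0, e3, e4, ← mul_assoc, ← hmul, mul_assoc, ← mul_pow, ← map_mul,
    hε, map_one, one_pow, mul_one,
    hψ]

lemma exists_bernoulli_mul_eq {p k : ℕ} (hp : p.Prime) (hk : 0 < k) (hpk : (p - 1) ∣ 2 * k) :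
    ∃ (Q : ℕ) (w : ℤ), ¬ (p : ℤ) ∣ w ∧ bernoulli (2 * k) * (p * Q) = w := by
  obtain ⟨n, hn⟩ := Bernoulli.vonStaudt_clausen k
  set S := (Finset.range (2 * k + 2)).filter fun q => q.Prime ∧ (q - 1) ∣ 2 * k with hS
  have hpS : p ∈ S := by
    have := Nat.le_of_dvd (by omega) hpk
    simp only [hS, Finset.mem_filter, Finset.mem_range]
    exact ⟨by omega, hp, hpk⟩
  have hprime : ∀ q ∈ S, q.Prime := fun q hq => (Finset.mem_filter.mp hq).2.1
  set Q := ∏ q ∈ S.erase p, q with hQ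
  have hcop : ¬ p ∣ Q := by
    rw [hQ, hp.prime.dvd_finsetProd_iff]
    rintro ⟨q, hq, hpq⟩
    rw [Finset.mem_erase] at hq
    exact hq.1 ((Nat.prime_dvd_prime_iff_eq hp (hprime q hq.2)).mp hpq).symm
  have hsum : (∑ q ∈ S.erase p, (1 : ℚ) / q) * Q = (∑ q ∈ S.erase p, Q / q : ℕ) := by
    rw [Finset.sum_mul, Nat.cast_sum]
    refine Finset.sum_congr rfl fun q hq => ?_
    rw [Nat.cast_div (Finset.dvd_prod_of_mem _ hq)
      (by exact_mod_cast (hprime q (Finset.mem_of_mem_erase hq)).ne_zero)]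
    ring
  have hp0 : (p : ℚ) ≠ 0 := by exact_mod_cast hp.ne_zero
  refine ⟨Q, p * (n * Q - (∑ q ∈ S.erase p, Q / q : ℕ)) - Q, ?_, ?_⟩
  · rw [dvd_sub_right (dvd_mul_right _ _)]
    exact_mod_cast hcop
  · rw [← Finset.add_sum_erase S _ hpS] at hn
    have : bernoulli (2 * k) = n - 1 / p - ∑ q ∈ S.erase p, (1 : ℚ) / q := by
      rw [hn]; ring
    rw [this, sub_mul, mul_left_comm (∑ q ∈ S.erase p, (1 : ℚ) / q), hsum, Int.cast_sub,
      Int.cast_mul, Int.cast_sub, Int.cast_mul, Int.cast_natCast, Int.cast_natCast,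
      Int.cast_natCast]
    field_simp
    ring

section LevelOneUnit

lemma CongMod.pIntegral {L : Subfield ℂ} {P : Ideal (𝓞 L)} {x : ℂ}
    (h : CongMod L P 1 x 0) : PIntegral L P x := by
  obtain ⟨a, b, -, hb, h⟩ := congMod_one_zero_iff.mp h
  exact ⟨a, b, hb, h⟩


variable {L : Subfield ℂ} {P : Ideal (𝓞 L)} [hP : P.IsPrime]

lemma intCast_notMem_of_not_dvd {p : ℕ} (hp : p.Prime) (hpP : (p : 𝓞 L) ∈ P) {w : ℤ}
    (hw : ¬ (p : ℤ) ∣ w) : (w : 𝓞 L) ∉ P := by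
  intro h
  obtain ⟨x, y, hxy⟩ := ((Nat.prime_iff_prime_int.mp hp).coprime_iff_not_dvd).mpr hw
  refine (Ideal.ne_top_iff_one P).mp hP.ne_top ?_
  have : (1 : 𝓞 L) = x * (p : 𝓞 L) + y * (w : 𝓞 L) := by exact_mod_cast hxy.symm
  rw [this]
  exact P.add_mem (P.mul_mem_left _ hpP) (P.mul_mem_left _ h)

lemma congMod_eisenstein_coeff {p k : ℕ} (hp : p.Prime) (hpP : (p : 𝓞 L) ∈ P) (hk : 0 < k)
    (hpk : (p - 1) ∣ 2 * k) (s : ℕ) :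
    CongMod L P 1 (-(2 * (2 * k : ℕ) / bernoulli (2 * k) : ℂ) * s) 0 := by
  obtain ⟨Q, w, hw, h⟩ := exists_bernoulli_mul_eq hp hk hpk
  have hw0 : (w : ℂ) ≠ 0 := by
    rintro h0
    rw [Int.cast_eq_zero] at h0
    exact hw (h0 ▸ dvd_zero _)
  have h' : (bernoulli (2 * k) : ℂ) * (p * Q) = w := by exact_mod_cast congrArg (Rat.cast : ℚ → ℂ) h
  have hB : (bernoulli (2 * k) : ℂ) ≠ 0 := fun hB => hw0 (by rw [← h', hB, zero_mul])
  refine congMod_one_zero_iff.mpr ⟨-(2 * (2 * k : ℕ) * (p * Q) * s), w, ?_,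
    intCast_notMem_of_not_dvd hp hpP hw, ?_⟩
  · refine P.neg_mem (P.mul_mem_right _ (P.mul_mem_left _ (P.mul_mem_right _ hpP)))
  · have e1 : (((w : 𝓞 L) : L) : ℂ) = w := rfl
    have e2 : (((-(2 * (2 * k : ℕ) * (p * Q) * s) : 𝓞 L) : L) : ℂ) =
      -(2 * (2 * k : ℕ) * (p * Q) * s) := by push_cast; rfl
    rw [e1, e2, ← h']
    field_simp

variable (L P) in
/-- A modular form of level one and weight `W` with `P`-integral Fourier coefficients that is
congruent to `1` modulo `P`. -/
structure IsLevelOneUnit (W : ℕ) (A : ℍ → ℂ) (α : PowerSeries (pIntegers L P)) : Prop where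
  qSeries : QSeries A (α.map (pIntegers L P).subtype)
  map_eq_one : α.map (Ideal.Quotient.mk (pIdeal L P)) = 1
  smul : ∀ (γ : SL(2, ℤ)) (τ : ℍ), A (γ • τ) = denomC γ τ ^ W * A τ

lemma isLevelOneUnit_one : IsLevelOneUnit L P 0 (fun _ => 1) 1 where
  qSeries := by simpa using QSeries.one
  map_eq_one := map_one _
  smul _ _ := by simp

lemma exists_isLevelOneUnit {p W : ℕ} (hp : p.Prime) (hpP : (p : 𝓞 L) ∈ P) (hW : 3 ≤ W)
    (hW2 : Even W) (hpW : (p - 1) ∣ W) : ∃ A α, IsLevelOneUnit L P W A α := by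
  obtain ⟨k, rfl⟩ := hW2.two_dvd
  have hc : ∀ m, PIntegral L P (if m = 0 then (1 : ℂ) else
      -(2 * (2 * k : ℕ) / bernoulli (2 * k) : ℂ) * (ArithmeticFunction.sigma (2 * k - 1) m : ℕ)) := by
    intro m
    split_ifs
    · exact (pIntegers L P).one_mem
    · exact (congMod_eisenstein_coeff hp hpP (by omega) hpW _).pIntegral
  refine ⟨ModularForm.E hW, PowerSeries.mk fun m => ⟨_, hc m⟩, fun τ => ?_, ?_, fun γ τ => ?_⟩
  · refine (ModularForm.hasSum_qExpansion (Γ := 𝒮ℒ) (f := ModularForm.E hW) one_pos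
      one_mem_strictPeriods_SL τ).of_eq fun m => ?_
    rw [EisensteinSeries.E_qExpansion_coeff hW hW2]
    simp
  · ext m
    rw [PowerSeries.coeff_map, PowerSeries.coeff_mk, PowerSeries.coeff_one]
    split_ifs with h
    · subst h
      exact map_one (Ideal.Quotient.mk (pIdeal L P))
    · rw [Ideal.Quotient.eq_zero_iff_mem, mem_pIdeal]
      exact congMod_eisenstein_coeff hp hpP (by omega) hpW _
  · have := SlashInvariantForm.slash_action_eqn'' (ModularForm.E hW)
      (γ := (γ : GL (Fin 2) ℝ)) (MonoidHom.mem_range.mpr ⟨γ, rfl⟩) τ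
    rw [← denom_eq_denomC]
    exact_mod_cast this

end LevelOneUnit

section CuspForm

variable {N lam m s W e M : ℕ} {f A D D₀ : ℍ → ℂ} {δ : PowerSeries ℤ}

lemma IsCuspFormHalf.tendsto_norm (hf : IsCuspFormHalf N lam f) (γ : SL(2, ℤ)) :
    Tendsto (fun τ => ‖f (γ • τ)‖ ^ 4 / ‖denomC γ τ‖ ^ (4 * lam + 2)) atImInfty (𝓝 0) := by
  have h := ((hf.decay γ).norm.pow 4)
  rw [norm_zero, zero_pow four_ne_zero] at h
  refine h.congr fun τ => ?_
  have h0 := denomC_ne_zero γ τ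
  have hpos : 0 < ‖denomC γ τ‖ := norm_pos_iff.mpr h0
  have e1 : (-(((lam : ℤ) : ℂ) + 1 / 2)) = (((-(lam + 1 / 2 : ℝ)) : ℝ) : ℂ) := by push_cast; rfl
  rw [norm_mul, e1, Complex.norm_cpow_real, mul_pow, ← Real.rpow_natCast (_ ^ _), ← Real.rpow_mul hpos.le,
    div_eq_inv_mul (‖f (γ • τ)‖ ^ 4), ← Real.rpow_natCast _ (4 * lam + 2), ← Real.rpow_neg hpos.le]
  congr 2
  push_cast; ring

lemma IsCuspFormHalf.tendsto (hf : IsCuspFormHalf N lam f) : Tendsto f atImInfty (𝓝 0) := by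
  have h : Tendsto (fun τ => f τ) (comap UpperHalfPlane.im atTop) (𝓝 0) := by
    simpa using hf.decay 1
  exact h

variable {L : Subfield ℂ} {P : Ideal (𝓞 L)} [hP : P.IsPrime] {α : PowerSeries (pIntegers L P)}

lemma IsLevelOneUnit.tendsto_norm (hA : IsLevelOneUnit L P W A α) (γ : SL(2, ℤ)) :
    ∃ l, Tendsto (fun τ => ‖A (γ • τ)‖ ^ 4 / ‖denomC γ τ‖ ^ (4 * W)) atImInfty (𝓝 l) := by
  refine ⟨_, (hA.qSeries.tendsto.norm.pow 4).congr fun τ => ?_⟩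
  have hpos : 0 < ‖denomC γ τ‖ := norm_pos_iff.mpr (denomC_ne_zero γ τ)
  rw [hA.smul, norm_mul, norm_pow, mul_pow, ← pow_mul, mul_comm W,
    mul_div_cancel_left₀ _ (pow_ne_zero _ hpos.ne')]

lemma tendsto_zero_of_pow_four {ι : Type*} {l : Filter ι} {u : ι → ℝ} (hu : ∀ i, 0 ≤ u i)
    (h : Tendsto (fun i => u i ^ 4) l (𝓝 0)) : Tendsto u l (𝓝 0) := by
  have h1 := h.sqrt.sqrt
  rw [Real.sqrt_zero, Real.sqrt_zero] at h1
  refine h1.congr fun i => ?_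
  rw [show u i ^ 4 = (u i ^ 2) ^ 2 by ring, Real.sqrt_sq (by positivity), Real.sqrt_sq (hu i)]

lemma IsCuspFormHalf.tendsto_quotient (hf : IsCuspFormHalf N lam f) (hA : IsLevelOneUnit L P W A α)
    (hD : IsDenominator m s D D₀ δ) (hwt : 2 * lam + 1 + e + 2 * W = 4 + s * M)
    {γ : SL(2, ℤ)} (hγ : γ ∉ Gamma0 m) :
    Tendsto (fun τ => ‖f (γ • τ) * Theta (γ • τ) ^ e * A (γ • τ) / D (γ • τ) ^ M‖ /
      ‖denomC γ τ‖ ^ 2) atImInfty (𝓝 0) := by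
  refine tendsto_zero_of_pow_four (fun τ => by positivity) ?_
  obtain ⟨lT, hT⟩ := exists_tendsto_norm_Theta γ
  obtain ⟨lA, hA'⟩ := hA.tendsto_norm γ
  obtain ⟨l, hl, hD'⟩ := hD.tendsto γ hγ
  have h := (((hf.tendsto_norm γ).mul (hT.pow e)).mul hA').div (hD'.pow M) (pow_ne_zero M hl.ne')
  rw [zero_mul, zero_mul, zero_div] at h
  refine h.congr fun τ => ?_
  have hpos : 0 < ‖denomC γ τ‖ := norm_pos_iff.mpr (denomC_ne_zero γ τ)
  have hDpos : 0 < ‖D (γ • τ)‖ := norm_pos_iff.mpr (hD.ne_zero _)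
  simp only [norm_div, norm_mul, norm_pow, div_pow, mul_pow, Pi.div_apply, ← pow_mul]
  have hx : ‖denomC γ τ‖ ^ (4 * lam + 2) * ‖denomC γ τ‖ ^ (2 * e) * ‖denomC γ τ‖ ^ (4 * W) =
      ‖denomC γ τ‖ ^ (2 * s * M) * ‖denomC γ τ‖ ^ (2 * 4) := by
    rw [← pow_add, ← pow_add, ← pow_add]
    congr 1
    linarith
  rw [div_mul_div_comm, div_mul_div_comm, hx, div_div_div_eq, div_div, mul_comm M 4, mul_comm e 4,
    mul_right_comm _ _ (‖D (γ • τ)‖ ^ (4 * M)), mul_comm (_ * _) (‖denomC γ τ‖ ^ (2 * s * M)),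
    mul_assoc (_ ^ (2 * s * M)),
    mul_div_mul_left _ _ (pow_pos hpos _).ne']

lemma IsCuspFormHalf.quotient_smul (hf : IsCuspFormHalf N lam f) (hA : IsLevelOneUnit L P W A α)
    (hD : IsDenominator m s D D₀ δ) (hW : Even W) (hwt : 2 * lam + 1 + e + 2 * W = 4 + s * M)
    (hm : Gamma0 m ≤ Gamma0 (4 * N)) {γ : SL(2, ℤ)} (hγ : γ ∈ Gamma0 m) (τ : ℍ) :
    f (γ • τ) * Theta (γ • τ) ^ e * A (γ • τ) / D (γ • τ) ^ M =
      denomC γ τ ^ 2 * (f τ * Theta τ ^ e * A τ / D τ ^ M) := by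
  have hγ4 : γ ∈ Gamma0 4 := Gamma0_le (dvd_mul_right 4 N) (hm hγ)
  set j := Theta (γ • τ) / Theta τ with hj
  have hT := Theta_ne_zero τ
  have hj0 : j ≠ 0 := div_ne_zero (Theta_ne_zero _) hT
  have hθ : Theta (γ • τ) = j * Theta τ := (div_mul_cancel₀ _ hT).symm
  have hj4 : denomC γ τ ^ 2 = j ^ 4 := by
    rw [hj, div_pow, Theta_smul_pow_four hγ4, mul_div_cancel_right₀ _ (pow_ne_zero _ hT)]
  obtain ⟨V, rfl⟩ := hW.two_dvd
  have hft := hf.toIsHoloForm.transf γ (hm hγ) τ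
  rw [← hj, show (2 * (lam : ℤ) + 1) = ((2 * lam + 1 : ℕ) : ℤ) by push_cast; rfl, zpow_natCast]
    at hft
  rw [hft, hA.smul, hD.smul γ hγ, ← hj, hθ, pow_mul (denomC γ τ), hj4]
  have hD0 := hD.ne_zero τ
  have hx : j ^ (2 * lam + 1) * j ^ e * (j ^ 4) ^ V = j ^ 4 * (j ^ s) ^ M := by
    rw [← pow_mul, ← pow_mul, ← pow_add, ← pow_add, ← pow_add]
    congr 1
    linarith
  rw [mul_pow, mul_pow, ← mul_div_assoc, div_eq_div_iff (by positivity) (by positivity)]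
  linear_combination (f τ * Theta τ ^ e * A τ * D τ ^ M) * hx

variable {a : ℤ → ℂ}

lemma IsCuspFormHalf.exists_coeff_eq_zero [NeZero m] (hf : IsCuspFormHalf N lam f)
    (ha : FourierAtInfty f a) (hA : IsLevelOneUnit L P W A α)
    (hD : IsDenominator m s D D₀ δ) (hW : Even W) (hwt : 2 * lam + 1 + e + 2 * W = 4 + s * M)
    (hm : Gamma0 m ≤ Gamma0 (4 * N)) :
    ∃ ψ : PowerSeries ℂ, ψ.coeff M = 0 ∧ ψ * (δ.map (Int.castRingHom ℂ)) ^ M =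
      PowerSeries.mk (fun n => a n) *
        (thetaSeries.map (Int.castRingHom (pIntegers L P)) ^ e * α).map
          (pIntegers L P).subtype := by
  have hq := ((ha.qSeries fun m hm => ha.eq_zero_of_nonpos hf.tendsto hm.le).mul
    (QSeries.theta.pow e)).mul hA.qSeries
  obtain ⟨ψ, h0, h⟩ := hD.exists_coeff_eq_zero hq M
    (fun γ hγ τ => hf.quotient_smul hA hD hW hwt hm hγ τ)
    (fun γ hγ => hf.tendsto_quotient hA hD hwt hγ)
  refine ⟨ψ, h0, h.trans ?_⟩
  rw [mul_assoc, map_mul, map_pow]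
  congr 3

lemma IsCuspFormHalf.congMod [NeZero m] {p b : ℕ} (hp : p.Prime) (hpP : (p : 𝓞 L) ∈ P)
    (hf : IsCuspFormHalf N lam f)
    (ha : FourierAtInfty f a) (haInt : ∀ n, PIntegral L P (a n))
    (hA : IsLevelOneUnit L P W A α)
    (hD : IsDenominator m s D D₀ δ) (hW : Even W) (hm : Gamma0 m ≤ Gamma0 (4 * N))
    (he : ∀ n, 0 < n → ∃ e, (p = 2 ∨ p ^ b ∣ e) ∧
      2 * lam + 1 + e + 2 * W = 4 + s * (p ^ b * n)) (n : ℕ) :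
    CongMod L P 1 (a (n * p ^ b : ℤ)) 0 := by
  have hpb : p ^ b ≠ 0 := pow_ne_zero _ hp.ne_zero
  have : Fact p.Prime := ⟨hp⟩
  have := charP_quotient_pIdeal (L := L) hp hpP
  have key := congMod_of_coeff_eq_zero (L := L) (P := P) hp hpP b hpb (a := fun n : ℕ => a n)
    (fun n => haInt n) (ha.eq_zero_of_nonpos hf.tendsto (by simp)) hD.coeff_zero
    (fun n hn => ?_) n
  · rw [mul_comm]; exact_mod_cast key
  obtain ⟨e, he, hwt⟩ := he n hn
  obtain ⟨ψ, h0, h⟩ := hf.exists_coeff_eq_zero (L := L) (P := P) ha hA hD hW hwt hm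
  set θ := thetaSeries.map (Int.castRingHom (pIntegers L P ⧸ pIdeal L P)) with hθ
  have hθ0 : θ.coeff 0 = 1 := by
    rw [hθ, PowerSeries.coeff_map, coeff_zero_thetaSeries, map_one]
  have hred : (thetaSeries.map (Int.castRingHom (pIntegers L P)) ^ e * α).map
      (Ideal.Quotient.mk (pIdeal L P)) = θ ^ e := by
    rw [map_mul, map_pow, hA.map_eq_one, mul_one, hθ]
    congr 1
  have hβ : ∃ β : PowerSeries (pIntegers L P ⧸ pIdeal L P),
      θ ^ e = PowerSeries.expand (p ^ b) hpb β ∧ β.coeff 0 = 1 := by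
    obtain rfl | ⟨e, rfl⟩ := he
    · refine ⟨1, ?_, by simp⟩
      have : θ = 1 := by
        have h2 : (2 : pIntegers L P ⧸ pIdeal L P) = 0 := by
          exact_mod_cast CharP.cast_eq_zero (pIntegers L P ⧸ pIdeal L P) 2
        have h2' : (2 : PowerSeries (pIntegers L P ⧸ pIdeal L P)) = 0 := by
          rw [← map_ofNat (PowerSeries.C (R := pIntegers L P ⧸ pIdeal L P)) 2, h2, map_zero]
        rw [hθ, thetaSeries, map_add, map_mul, map_one, map_ofNat, h2', zero_mul, add_zero]
      rw [this, one_pow, map_one]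
    · obtain ⟨β, hβ0, hβ⟩ := pow_prime_pow_eq_expand p θ b hpb
      refine ⟨β ^ e, ?_, ?_⟩
      · rw [pow_mul, hβ, map_pow]
      · rw [PowerSeries.coeff_zero_eq_constantCoeff_apply, map_pow,
          ← PowerSeries.coeff_zero_eq_constantCoeff_apply, hβ0, hθ0, one_pow, one_pow]
  obtain ⟨β, hβ, hβ0⟩ := hβ
  exact ⟨ψ, _, β, h0, h, hred.trans hβ, hβ0⟩

end CuspForm

lemma exists_weight {p lam c κ : ℕ} (hp : p.Prime) (hodd : Odd p) (hκ : Odd κ)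
    (h : lam ≡ c [MOD (p - 1) / 2]) :
    ∃ b W : ℕ, 0 < b ∧ Even W ∧ (p - 1) ∣ W ∧ 3 ≤ W ∧
      2 * W + 2 * lam + κ = κ * p ^ b + 2 * c := by
  obtain ⟨k, rfl⟩ := hodd
  rw [show (2 * k + 1 - 1) / 2 = k by omega] at h
  obtain ⟨r, hr⟩ := h.symm.dvd
  obtain ⟨ε, hε⟩ : ∃ ε : ℕ, Even (κ * ε - r : ℤ) := by
    obtain ⟨κ, rfl⟩ := hκ
    obtain ⟨s, rfl⟩ | ⟨s, rfl⟩ := Int.even_or_odd r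
    · exact ⟨0, -s, by push_cast; ring⟩
    · exact ⟨1, κ - s, by push_cast; ring⟩
  obtain ⟨v, hv⟩ := hε
  obtain ⟨t, ht⟩ : ((4 * k : ℕ) : ℤ) ∣
      ((2 * k + 1 : ℕ) : ℤ) ^ (2 * (lam + 4) + ε) - (1 + 2 * k * ε) := by
    have h1 : ((4 * k : ℕ) : ℤ) ∣ (((2 * k + 1 : ℕ) : ℤ) ^ 2) ^ (lam + 4) - 1 := by
      refine dvd_trans ⟨k + 1, by push_cast; ring⟩ (sub_one_dvd_pow_sub_one _ _)
    have h2 : ∀ ε : ℕ, ((4 * k : ℕ) : ℤ) ∣ ((2 * k + 1 : ℕ) : ℤ) ^ ε - (1 + 2 * k * ε) := by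
      intro ε
      induction ε with
      | zero => simp
      | succ ε ih =>
        rw [pow_succ]
        refine (dvd_add (ih.mul_right (2 * k + 1)) (dvd_mul_right _ (k * ε : ℤ))).trans
          (dvd_of_eq ?_)
        push_cast; ring
    rw [pow_add, pow_mul]
    refine (dvd_add (h1.mul_right (((2 * k + 1 : ℕ) : ℤ) ^ ε)) (h2 ε)).trans (dvd_of_eq ?_)
    ring
  have hlt : 2 * (lam + 4) + ε < (2 * k + 1) ^ (2 * (lam + 4) + ε) := Nat.lt_pow_self hp.one_lt
  set P₀ := (2 * k + 1) ^ (2 * (lam + 4) + ε) with hP₀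
  have ht' : (P₀ : ℤ) = 1 + 2 * k * ε + 4 * k * t := by
    rw [hP₀]; push_cast at ht ⊢; linarith
  have hκ1 : (P₀ : ℤ) - 1 ≤ κ * (P₀ - 1) :=
    le_mul_of_one_le_left (by omega) (by exact_mod_cast hκ.pos)
  have hW : 2 * ((2 * k : ℤ) * (v + κ * t)) + 2 * lam + κ = κ * P₀ + 2 * c := by
    rw [ht']
    linear_combination (-2 * k : ℤ) * hv + 2 * hr
  obtain ⟨w, hw⟩ : ∃ w : ℕ, v + κ * t = w := by
    refine Int.eq_ofNat_of_zero_le (le_of_not_gt fun hneg => ?_)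
    have : (2 * k : ℤ) * (v + κ * t) ≤ 0 := mul_nonpos_of_nonneg_of_nonpos (by positivity) hneg.le
    linarith
  rw [hw] at hW
  refine ⟨2 * (lam + 4) + ε, 2 * k * w, by omega, ⟨k * w, by ring⟩, ⟨w, by simp⟩, ?_, ?_⟩
  · zify; linarith
  · exact_mod_cast (by linarith : 2 * (2 * (k : ℤ) * w) + 2 * lam + κ = κ * P₀ + 2 * c)

/-- For a cusp form `f` of weight `λ + 1/2` on `Γ₀(4N)`, `N ∈ {1,2,4}`, whose
Fourier coefficients at `∞` lie in `L` and are `𝔭`-integral, with `p = 2`, or `p` odd and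
`λ ≡ 2 (mod (p-1)/2)`, or `N = 1` and `λ ≡ 3 (mod (p-1)/2)`: there exists `b ≥ 1` with
`a_f(n·p^b) ≡ 0 (mod 𝔭)` for every positive integer `n`. -/
theorem statement2
    (N : ℕ) (hN : N = 1 ∨ N = 2 ∨ N = 4) (lam : ℕ)
    (p : ℕ) (hp : p.Prime)
    (L : Subfield ℂ) [NumberField L]
    (P : Ideal (𝓞 L)) (hPprime : P.IsPrime) (hPp : (p : 𝓞 L) ∈ P)
    (f : ℍ → ℂ) (hf : IsCuspFormHalf N (lam : ℤ) f)
    (a : ℤ → ℂ) (ha : FourierAtInfty f a)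
    (haL : ∀ n : ℤ, a n ∈ L)
    (haInt : ∀ n : ℤ, PIntegral L P (a n))
    (hcase : p = 2 ∨ (Odd p ∧
      (lam ≡ 2 [MOD (p - 1) / 2] ∨ (N = 1 ∧ lam ≡ 3 [MOD (p - 1) / 2])))) :
    ∃ b : ℕ, 0 < b ∧ ∀ n : ℕ, 0 < n → CongMod L P 1 (a (n * p ^ b)) 0 := by
  have := hPprime
  have h16 : Gamma0 16 ≤ Gamma0 (4 * N) := Gamma0_le (by rcases hN with rfl | rfl | rfl <;> norm_num)
  obtain rfl | ⟨hodd, h | ⟨rfl, h⟩⟩ := hcase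
  · refine ⟨lam + 1, lam.succ_pos, fun n _ => ?_⟩
    rw [Nat.cast_ofNat]
    refine hf.congMod hp hPp ha haInt isLevelOneUnit_one isDenominator_sixteen Even.zero h16
      (fun n hn => ⟨2 ^ (lam + 1) * n + 3 - 2 * lam, Or.inl rfl, ?_⟩) n
    have h1 : lam < 2 ^ lam := Nat.lt_two_pow_self
    have h2 := Nat.le_mul_of_pos_right (2 ^ (lam + 1)) hn
    rw [pow_succ] at h2 ⊢
    omega
  · obtain ⟨b, W, hb, hW, hpW, hW3, hwt⟩ := exists_weight hp hodd odd_one h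
    obtain ⟨A, α, hA⟩ := exists_isLevelOneUnit (L := L) hp hPp hW3 hW hpW
    refine ⟨b, hb, fun n _ => hf.congMod hp hPp ha haInt hA isDenominator_sixteen hW h16
      (fun n hn => ⟨p ^ b * (n - 1), Or.inr (dvd_mul_right _ _), ?_⟩) n⟩
    obtain ⟨n, rfl⟩ := Nat.exists_eq_add_of_lt hn
    rw [zero_add, Nat.add_sub_cancel]
    linarith
  · obtain ⟨b, W, hb, hW, hpW, hW3, hwt⟩ := exists_weight (κ := 3) hp hodd (by decide) h
    obtain ⟨A, α, hA⟩ := exists_isLevelOneUnit (L := L) hp hPp hW3 hW hpW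
    refine ⟨b, hb, fun n _ => hf.congMod hp hPp ha haInt hA isDenominator_four hW le_rfl
      (fun n hn => ⟨p ^ b * (4 * n - 3), Or.inr (dvd_mul_right _ _), ?_⟩) n⟩
    obtain ⟨n, rfl⟩ := Nat.exists_eq_add_of_lt hn
    rw [show 4 * (0 + n + 1) - 3 = 4 * n + 1 by omega]
    linarith

end
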